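/- Any chain of elementary moves from a rectangular diagram of a link R to a rectangular diagram of a link R' can be replaced by a chain of elementary moves from R to R' which consists of a sequence of stabilizations, followed by a sequence of exchange moves, followed by a sequence of destabilizations; moreover, for every oriented type t ∈ {→I, ←I, →II, ←II} and every component number i, the number of stabilizations (respectively, of destabilizations) of oriented type t performed on the component number i in the new chain equals the corresponding number in the original chain. -/

import Mathlib

open scoped Real

noncomputable section

namespace RectDiag

instance : DecidableEq Real.Angle := Classical.decEq _

/-- The torus `T² = S¹ × S¹` with angular coordinates `(θ, φ)`. -/
abbrev Torus := Real.Angle × Real.Angle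

/-- The length of the arc running from `x` to `y` in the positive direction. -/
def arcLen (x y : Real.Angle) : ℝ :=
  if (y - x).toReal < 0 then (y - x).toReal + 2 * Real.pi else (y - x).toReal

/-- The closed arc `[x;y]` running from `x` to `y` in the positive direction. -/
def Arc (x y : Real.Angle) : Set Real.Angle :=
  {z | ∃ t : ℝ, 0 ≤ t ∧ t ≤ arcLen x y ∧ z = x + (t : Real.Angle)}

/-- The open arc `(x;y)`, the interior of `[x;y]`. -/
def ArcInt (x y : Real.Angle) : Set Real.Angle :=
  {z | ∃ t : ℝ, 0 < t ∧ t < arcLen x y ∧ z = x + (t : Real.Angle)}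

/-- Every meridian `{θ}×S¹` contains no or exactly two points of `V`, of opposite signs. -/
def MeridianOK (V : Finset Torus) (sgn : Torus → Bool) : Prop :=
  ∀ θ : Real.Angle, (∀ v ∈ V, v.1 ≠ θ) ∨
    ∃ u w, u ∈ V ∧ w ∈ V ∧ u ≠ w ∧ u.1 = θ ∧ w.1 = θ ∧ sgn u ≠ sgn w ∧
      ∀ x ∈ V, x.1 = θ → x = u ∨ x = w

/-- Every longitude `S¹×{φ}` contains no or exactly two points of `V`, of opposite signs. -/
def LongitudeOK (V : Finset Torus) (sgn : Torus → Bool) : Prop :=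
  ∀ φ : Real.Angle, (∀ v ∈ V, v.2 ≠ φ) ∨
    ∃ u w, u ∈ V ∧ w ∈ V ∧ u ≠ w ∧ u.2 = φ ∧ w.2 = φ ∧ sgn u ≠ sgn w ∧
      ∀ x ∈ V, x.2 = φ → x = u ∨ x = w

/-- `V` with sign assignment `sgn` satisfies the conditions of a rectangular diagram. -/
def IsDiagSet (V : Finset Torus) (sgn : Torus → Bool) : Prop :=
  MeridianOK V sgn ∧ LongitudeOK V sgn

/-- `S` is a connected component of `V`: a minimal nonempty subset of `V` that is itself a
rectangular diagram of a link (with the inherited signs). -/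
def IsComponent (V : Finset Torus) (sgn : Torus → Bool) (S : Finset Torus) : Prop :=
  S ⊆ V ∧ S.Nonempty ∧ IsDiagSet S sgn ∧
    ∀ S' ⊆ S, S'.Nonempty → IsDiagSet S' sgn → S' = S

/-- An oriented rectangular diagram of a link with numbered connected components:
a finite subset of the torus with a sign assignment satisfying the meridian/longitude
conditions, together with a numbering of the vertices which is constant exactly on
connected components. -/
structure RectDiagram where
  verts : Finset Torus
  sgn : Torus → Bool
  comp : Torus → ℕ
  diag : IsDiagSet verts sgn
  comp_eq_iff : ∀ u ∈ verts, ∀ v ∈ verts,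
    (comp u = comp v ↔ ∃ S, IsComponent verts sgn S ∧ u ∈ S ∧ v ∈ S)

/-- `{u,v}` is a (vertical or horizontal) edge of the diagram `R`. -/
def IsEdge (R : RectDiagram) (u v : Torus) : Prop :=
  u ∈ R.verts ∧ v ∈ R.verts ∧ u ≠ v ∧ (u.1 = v.1 ∨ u.2 = v.2)

/-- The four corner points `{θ₁,θ₂}×{φ₁,φ₂}`. -/
def corners (t1 t2 p1 p2 : Real.Angle) : Finset Torus :=
  {(t1, p1), (t1, p2), (t2, p1), (t2, p2)}

/-- The rectangle `[θ₁;θ₂]×[φ₁;φ₂] ⊆ T²`. -/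
def RectSet (t1 t2 p1 p2 : Real.Angle) : Set Torus :=
  {p | p.1 ∈ Arc t1 t2 ∧ p.2 ∈ Arc p1 p2}

/-- `R₁ ↦ R₂` is an elementary move associated with the rectangle `[θ₁;θ₂]×[φ₁;φ₂]`. -/
def IsElemMoveWith (R₁ R₂ : RectDiagram) (t1 t2 p1 p2 : Real.Angle) : Prop :=
  t1 ≠ t2 ∧ p1 ≠ p2 ∧
  symmDiff R₁.verts R₂.verts = corners t1 t2 p1 p2 ∧
  (∃ u v : Torus, u ∈ symmDiff R₁.verts R₂.verts ∧ v ∈ symmDiff R₁.verts R₂.verts ∧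
      (IsEdge R₁ u v ∨ IsEdge R₂ u v)) ∧
  ¬ R₁.verts ⊆ R₂.verts ∧ ¬ R₂.verts ⊆ R₁.verts ∧
  RectSet t1 t2 p1 p2 ∩ (↑R₁.verts ∪ ↑R₂.verts) = ↑(corners t1 t2 p1 p2) ∧
  ∀ v ∈ R₁.verts ∩ R₂.verts, R₁.sgn v = R₂.sgn v ∧ R₁.comp v = R₂.comp v

/-- `R₁ ↦ R₂` is an elementary move. -/
def IsElemMove (R₁ R₂ : RectDiagram) : Prop :=
  ∃ t1 t2 p1 p2 : Real.Angle, IsElemMoveWith R₁ R₂ t1 t2 p1 p2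

/-- An exchange move. -/
def IsExchange (R₁ R₂ : RectDiagram) : Prop :=
  IsElemMove R₁ R₂ ∧ R₂.verts.card = R₁.verts.card

/-- A stabilization. -/
def IsStab (R₁ R₂ : RectDiagram) : Prop :=
  IsElemMove R₁ R₂ ∧ R₂.verts.card = R₁.verts.card + 2

/-- A destabilization. -/
def IsDestab (R₁ R₂ : RectDiagram) : Prop :=
  IsElemMove R₁ R₂ ∧ R₁.verts.card = R₂.verts.card + 2

/-- A stabilization associated with a given rectangle. -/
def IsStabWith (R₁ R₂ : RectDiagram) (t1 t2 p1 p2 : Real.Angle) : Prop :=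
  IsElemMoveWith R₁ R₂ t1 t2 p1 p2 ∧ R₂.verts.card = R₁.verts.card + 2

/-- The type I corner condition: `R₁ ∩ V ⊆ {(θ₁,φ₁),(θ₂,φ₂)}`. -/
def TypeICornerCond (R₁ : RectDiagram) (t1 t2 p1 p2 : Real.Angle) : Prop :=
  ∀ v ∈ R₁.verts, v ∈ corners t1 t2 p1 p2 → v = (t1, p1) ∨ v = (t2, p2)

/-- The type II corner condition: `R₁ ∩ V ⊆ {(θ₁,φ₂),(θ₂,φ₁)}`. -/
def TypeIICornerCond (R₁ : RectDiagram) (t1 t2 p1 p2 : Real.Angle) : Prop :=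
  ∀ v ∈ R₁.verts, v ∈ corners t1 t2 p1 p2 → v = (t1, p2) ∨ v = (t2, p1)

/-- `R₁ ↦ R₂` is a type I stabilization. -/
def IsTypeIStab (R₁ R₂ : RectDiagram) : Prop :=
  ∃ t1 t2 p1 p2, IsStabWith R₁ R₂ t1 t2 p1 p2 ∧ TypeICornerCond R₁ t1 t2 p1 p2

/-- `R₁ ↦ R₂` is a type II stabilization. -/
def IsTypeIIStab (R₁ R₂ : RectDiagram) : Prop :=
  ∃ t1 t2 p1 p2, IsStabWith R₁ R₂ t1 t2 p1 p2 ∧ TypeIICornerCond R₁ t1 t2 p1 p2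

/-- `R₁ ↦ R₂` is a type I destabilization. -/
def IsTypeIDestab (R₁ R₂ : RectDiagram) : Prop := IsTypeIStab R₂ R₁

/-- `R₁ ↦ R₂` is a type II destabilization. -/
def IsTypeIIDestab (R₁ R₂ : RectDiagram) : Prop := IsTypeIIStab R₂ R₁

/-- The four oriented types `→I`, `←I`, `→II`, `←II` of (de)stabilizations. -/
inductive OType
  | posI
  | negI
  | posII
  | negII
deriving DecidableEq

/-- Whether an oriented type is of (unoriented) type I. -/
def OType.isI : OType → Bool
  | .posI => true
  | .negI => true
  | _ => false

/-- `R₁ ↦ R₂` is a stabilization of the given oriented type. -/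
def IsStabOfOType (R₁ R₂ : RectDiagram) (t : OType) : Prop :=
  ∃ t1 t2 p1 p2, IsStabWith R₁ R₂ t1 t2 p1 p2 ∧
    ∃ p0, (p0 = p1 ∨ p0 = p2) ∧ (t1, p0) ∈ R₂.verts ∧ (t2, p0) ∈ R₂.verts ∧
      (match t with
        | .posI => TypeICornerCond R₁ t1 t2 p1 p2 ∧ R₂.sgn (t2, p0) = true
        | .negI => TypeICornerCond R₁ t1 t2 p1 p2 ∧ R₂.sgn (t2, p0) = false
        | .posII => TypeIICornerCond R₁ t1 t2 p1 p2 ∧ R₂.sgn (t2, p0) = true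
        | .negII => TypeIICornerCond R₁ t1 t2 p1 p2 ∧ R₂.sgn (t2, p0) = false)

/-- `R₁ ↦ R₂` is a destabilization of the given oriented type. -/
def IsDestabOfOType (R₁ R₂ : RectDiagram) (t : OType) : Prop := IsStabOfOType R₂ R₁ t

/-- The move `R₁ ↦ R₂` is performed on (modifies) the connected component number `i`. -/
def ModifiesComp (R₁ R₂ : RectDiagram) (i : ℕ) : Prop :=
  ∃ v ∈ R₁.verts, v ∉ R₂.verts ∧ R₁.comp v = i

/-- The kind of an elementary move: an exchange, a stabilization of oriented type `t`
on the component number `i`, or a destabilization of oriented type `t` on the component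
number `i`. -/
inductive MoveKind
  | exchange
  | stab (t : OType) (i : ℕ)
  | destab (t : OType) (i : ℕ)
deriving DecidableEq

/-- The pair `(R₁, R₂)` is an elementary move realizing the given kind. -/
def KindOk (R₁ R₂ : RectDiagram) : MoveKind → Prop
  | .exchange => IsExchange R₁ R₂
  | .stab t i => IsStabOfOType R₁ R₂ t ∧ ModifiesComp R₁ R₂ i
  | .destab t i => IsDestabOfOType R₁ R₂ t ∧ ModifiesComp R₁ R₂ i

/-- `LChain R s R'` : `s` is a chain of elementary moves from `R` to `R'`, each move
labeled by its kind. -/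
def LChain : RectDiagram → List (MoveKind × RectDiagram) → RectDiagram → Prop
  | R, [], R' => R = R'
  | R, (k, S) :: rest, R' => KindOk R S k ∧ LChain S rest R'


/-- The representative of an angle in `[0, 2π)`. -/
def lin (z : Real.Angle) : ℝ := arcLen 0 z

lemma arcLen_eq_lin (x y : Real.Angle) : arcLen x y = lin (y - x) := by
  simp [lin, arcLen]

lemma lin_nonneg (z : Real.Angle) : 0 ≤ lin z := by
  have := Real.Angle.neg_pi_lt_toReal z
  have := Real.pi_pos
  simp only [lin, arcLen, sub_zero]
  split_ifs <;> linarith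

lemma lin_lt (z : Real.Angle) : lin z < 2 * Real.pi := by
  have := Real.Angle.toReal_le_pi z
  have := Real.pi_pos
  simp only [lin, arcLen, sub_zero]
  split_ifs <;> linarith

@[simp] lemma coe_lin (z : Real.Angle) : (lin z : Real.Angle) = z := by
  simp only [lin, arcLen, sub_zero]
  split_ifs <;> simp

lemma lin_injective : Function.Injective lin := fun a b h => by
  rw [← coe_lin a, ← coe_lin b, h]

lemma lin_coe {a : ℝ} (h0 : 0 ≤ a) (h1 : a < 2 * Real.pi) : lin (a : Real.Angle) = a := by
  have h : ((lin (a : Real.Angle) : ℝ) : Real.Angle) = a := coe_lin _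
  obtain ⟨k, hk⟩ := Real.Angle.angle_eq_iff_two_pi_dvd_sub.1 h
  have h2 := lin_nonneg (a : Real.Angle)
  have h3 := lin_lt (a : Real.Angle)
  have hp := Real.pi_pos
  have hk0 : k = 0 := by
    have hu : (k : ℝ) < 1 := by by_contra hc; nlinarith
    have hl : (-1 : ℝ) < k := by by_contra hc; nlinarith
    have hu' : k < 1 := by exact_mod_cast hu
    have hl' : -1 < k := by exact_mod_cast hl
    omega
  subst hk0
  simp at hk
  linarith

lemma lin_sub (x y : Real.Angle) :
    lin (y - x) = if lin x ≤ lin y then lin y - lin x else lin y - lin x + 2 * Real.pi := by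
  have hx := lin_nonneg x
  have hx' := lin_lt x
  have hy := lin_nonneg y
  have hy' := lin_lt y
  split_ifs with h
  · rw [← lin_coe (a := lin y - lin x) (by linarith) (by linarith)]
    simp
  · rw [← lin_coe (a := lin y - lin x + 2 * Real.pi) (by linarith) (by linarith)]
    simp

lemma mem_Arc_iff_lin_sub {x y z : Real.Angle} :
    z ∈ Arc x y ↔ lin (z - x) ≤ lin (y - x) := by
  constructor
  · rintro ⟨t, h0, h1, rfl⟩
    rw [arcLen_eq_lin] at h1
    rw [add_sub_cancel_left, lin_coe h0 (h1.trans_lt (lin_lt _))]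
    exact h1
  · intro h
    exact ⟨lin (z - x), lin_nonneg _, by rwa [arcLen_eq_lin], by simp⟩

lemma mem_Arc_iff {x y z : Real.Angle} :
    z ∈ Arc x y ↔ (lin x ≤ lin y ∧ lin x ≤ lin z ∧ lin z ≤ lin y) ∨
      (lin y < lin x ∧ (lin x ≤ lin z ∨ lin z ≤ lin y)) := by
  have hx := lin_lt x
  have hy := lin_nonneg y
  have hy' := lin_lt y
  have hz := lin_nonneg z
  have hz' := lin_lt z
  have hx' := lin_nonneg x
  rw [mem_Arc_iff_lin_sub, lin_sub, lin_sub]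
  split_ifs <;> grind

/-- The closed arc from `x` to `y`, running in the positive direction if `d` is true and in the
negative direction otherwise. -/
def DArc (d : Bool) (x y : Real.Angle) : Set Real.Angle := if d then Arc x y else Arc y x

lemma mem_DArc_iff {d : Bool} {x y z : Real.Angle} :
    z ∈ DArc d x y ↔ (d = true ∧ z ∈ Arc x y) ∨ (d = false ∧ z ∈ Arc y x) := by
  cases d <;> simp [DArc]

lemma DArc_not (d : Bool) (x y : Real.Angle) : DArc (!d) x y = DArc d y x := by
  cases d <;> simp [DArc]

@[simp] lemma left_mem_DArc (d : Bool) (x y : Real.Angle) : x ∈ DArc d x y := by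
  simp only [mem_DArc_iff, mem_Arc_iff]; grind

@[simp] lemma right_mem_DArc (d : Bool) (x y : Real.Angle) : y ∈ DArc d x y := by
  simp only [mem_DArc_iff, mem_Arc_iff]; grind

lemma mem_DArc_of_notMem {d : Bool} {x a b : Real.Angle} (h : a ∉ DArc d x b) :
    b ∈ DArc d x a := by
  simp only [mem_DArc_iff, mem_Arc_iff] at *; grind

lemma DArc_subset_left {d : Bool} {x a b : Real.Angle} (h : a ∈ DArc d x b) :
    DArc d x a ⊆ DArc d x b := by
  intro z
  simp only [mem_DArc_iff, mem_Arc_iff] at *; grind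

lemma DArc_subset_right {d : Bool} {x a b : Real.Angle} (h : a ∈ DArc d x b) :
    DArc d a b ⊆ DArc d x b := by
  intro z
  simp only [mem_DArc_iff, mem_Arc_iff] at *; grind

lemma notMem_DArc_right {d : Bool} {x a b : Real.Angle} (h : a ∈ DArc d x b) (hx : a ≠ x) :
    x ∉ DArc d a b := by
  have := lin_injective.ne hx
  simp only [mem_DArc_iff, mem_Arc_iff] at *; grind

lemma notMem_Arc_of_mem_DArc {d : Bool} {x a b s t : Real.Angle} (hx : x ∉ Arc s t)
    (hs : s ∉ DArc d x b) (ht : t ∉ DArc d x b) (ha : a ∈ DArc d x b) : a ∉ Arc s t := by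
  simp only [mem_DArc_iff, mem_Arc_iff] at *; grind

lemma exists_DArc_inter_subset (d : Bool) (x : Real.Angle) (F : Finset Real.Angle) :
    ∃ a, a ≠ x ∧ ∀ z ∈ F, z ∈ DArc d x a → z = x := by
  have hp := Real.pi_pos
  let G : Finset ℝ := insert (2 * Real.pi) ((F.erase x).image
    fun z => if d then lin (z - x) else lin (x - z))
  have hG : G.Nonempty := Finset.insert_nonempty _ _
  have hpos : ∀ g ∈ G, 0 < g := by
    intro g hg
    rcases Finset.mem_insert.1 hg with rfl | hg
    · linarith
    · obtain ⟨z, hz, rfl⟩ := Finset.mem_image.1 hg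
      have hzx : z ≠ x := (Finset.mem_erase.1 hz).1
      have key : ∀ w : Real.Angle, w ≠ 0 → 0 < lin w := fun w hw =>
        lt_of_le_of_ne (lin_nonneg w) fun h => hw (by rw [← coe_lin w, ← h]; simp)
      cases d
      · simpa using key _ (sub_ne_zero.2 hzx.symm)
      · simpa using key _ (sub_ne_zero.2 hzx)
  set m := G.min' hG
  have hm : 0 < m := hpos _ (G.min'_mem hG)
  have hm2 : m ≤ 2 * Real.pi := G.min'_le _ (Finset.mem_insert_self _ _)
  have hlin : lin ((m / 2 : ℝ) : Real.Angle) = m / 2 := lin_coe (by linarith) (by linarith)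
  have hne : ((m / 2 : ℝ) : Real.Angle) ≠ 0 := by
    intro h
    rw [h] at hlin
    have h0 : lin 0 = 0 := by simpa using lin_coe (a := 0) le_rfl (by linarith)
    linarith
  have hle : ∀ z ∈ F, z ≠ x → m ≤ if d then lin (z - x) else lin (x - z) := fun z hz hzx =>
    G.min'_le _ (Finset.mem_insert_of_mem (Finset.mem_image.2 ⟨z, Finset.mem_erase.2 ⟨hzx, hz⟩, rfl⟩))
  cases d
  · refine ⟨x - ((m / 2 : ℝ) : Real.Angle), by simpa using hne, fun z hz hza => ?_⟩
    by_contra hzx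
    have h1 := hle z hz hzx
    simp only [DArc, Bool.false_eq_true, if_false] at hza h1
    rw [mem_Arc_iff_lin_sub, sub_sub_cancel, hlin] at hza
    have h3 : lin (x - z) = m / 2 - lin (z - (x - ((m / 2 : ℝ) : Real.Angle))) := by
      rw [← lin_coe (a := m / 2 - lin (z - (x - ((m / 2 : ℝ) : Real.Angle)))) (by linarith)
        (by linarith [lin_nonneg (z - (x - ((m / 2 : ℝ) : Real.Angle)))]),
        Real.Angle.coe_sub, coe_lin]
      congr 1
      abel
    linarith [lin_nonneg (z - (x - ((m / 2 : ℝ) : Real.Angle)))]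
  · refine ⟨x + ((m / 2 : ℝ) : Real.Angle), by simpa using hne, fun z hz hza => ?_⟩
    by_contra hzx
    have h1 := hle z hz hzx
    simp only [DArc, if_true] at hza h1
    rw [mem_Arc_iff_lin_sub, add_sub_cancel_left, hlin] at hza
    linarith

/-- Two points of the torus lying on a common meridian or longitude. -/
def Aligned (u v : Torus) : Prop := u.1 = v.1 ∨ u.2 = v.2

lemma Aligned.symm {u v : Torus} (h : Aligned u v) : Aligned v u := h.imp Eq.symm Eq.symm

/-- Two points joined by a path in `V` along meridians and longitudes. -/
def Conn (V : Finset Torus) : Torus → Torus → Prop :=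
  Relation.ReflTransGen fun a b => a ∈ V ∧ b ∈ V ∧ Aligned a b

lemma Conn.symm {V : Finset Torus} {u v : Torus} (h : Conn V u v) : Conn V v u := by
  induction h with
  | refl => exact .refl
  | tail _ hab ih => exact .head ⟨hab.2.1, hab.1, hab.2.2.symm⟩ ih

lemma Conn.mem {V : Finset Torus} {u v : Torus} (h : Conn V u v) (hu : u ∈ V) : v ∈ V := by
  rcases Relation.ReflTransGen.cases_tail h with rfl | ⟨_, _, h⟩
  exacts [hu, h.2.1]

lemma forall_line_iff {V : Finset Torus} {sgn : Torus → Bool} (f : Torus → Real.Angle) :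
    (∀ θ : Real.Angle, (∀ v ∈ V, f v ≠ θ) ∨
      ∃ u w, u ∈ V ∧ w ∈ V ∧ u ≠ w ∧ f u = θ ∧ f w = θ ∧ sgn u ≠ sgn w ∧
        ∀ x ∈ V, f x = θ → x = u ∨ x = w) ↔
      (∀ a ∈ V, ∀ b ∈ V, f a = f b → sgn a = sgn b → a = b) ∧
        ∀ u ∈ V, ∃ w ∈ V, f w = f u ∧ sgn w ≠ sgn u := by
  constructor
  · intro h
    constructor
    · intro a ha b hb hab hs
      rcases h (f b) with h | ⟨u, w, hu, hw, -, -, -, hs', h⟩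
      · exact absurd rfl (h b hb)
      · have h1 := h a ha hab
        have h2 := h b hb rfl
        grind
    · intro a ha
      rcases h (f a) with h | ⟨u, w, hu, hw, -, hu1, hw1, hs', h⟩
      · exact absurd rfl (h a ha)
      · have h1 := h a ha rfl
        grind
  · rintro ⟨h1, h2⟩ θ
    by_cases h : ∃ v ∈ V, f v = θ
    · obtain ⟨v, hv, rfl⟩ := h
      obtain ⟨w, hw, hwv, hs⟩ := h2 v hv
      refine Or.inr ⟨v, w, hv, hw, fun h => hs (by rw [h]), rfl, hwv, hs.symm, fun x hx hxv => ?_⟩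
      by_cases hxs : sgn x = sgn v
      · exact Or.inl (h1 x hx v hv hxv hxs)
      · refine Or.inr (h1 x hx w hw (hxv.trans hwv.symm) ?_)
        revert hxs hs
        cases sgn x <;> cases sgn v <;> cases sgn w <;> simp
    · exact Or.inl fun v hv hv1 => h ⟨v, hv, hv1⟩

lemma meridianOK_iff {V : Finset Torus} {sgn : Torus → Bool} :
    MeridianOK V sgn ↔ (∀ a ∈ V, ∀ b ∈ V, a.1 = b.1 → sgn a = sgn b → a = b) ∧
      ∀ u ∈ V, ∃ w ∈ V, w.1 = u.1 ∧ sgn w ≠ sgn u :=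
  forall_line_iff Prod.fst

lemma longitudeOK_iff {V : Finset Torus} {sgn : Torus → Bool} :
    LongitudeOK V sgn ↔ (∀ a ∈ V, ∀ b ∈ V, a.2 = b.2 → sgn a = sgn b → a = b) ∧
      ∀ u ∈ V, ∃ w ∈ V, w.2 = u.2 ∧ sgn w ≠ sgn u :=
  forall_line_iff Prod.snd

lemma IsDiagSet.eq_of_aligned {V : Finset Torus} {sgn : Torus → Bool} (hV : IsDiagSet V sgn)
    {a b : Torus} (ha : a ∈ V) (hb : b ∈ V) (h : Aligned a b) (hs : sgn a = sgn b) : a = b :=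
  h.elim (fun h => (meridianOK_iff.1 hV.1).1 a ha b hb h hs)
    fun h => (longitudeOK_iff.1 hV.2).1 a ha b hb h hs

open scoped Classical in
lemma isDiagSet_conn {V : Finset Torus} {sgn : Torus → Bool} (hV : IsDiagSet V sgn) (u : Torus) :
    IsDiagSet {w ∈ V | Conn V u w} sgn := by
  have h1 := meridianOK_iff.1 hV.1
  have h2 := longitudeOK_iff.1 hV.2
  constructor
  · refine meridianOK_iff.2 ⟨fun a ha b hb => h1.1 a (Finset.mem_filter.1 ha).1 b
      (Finset.mem_filter.1 hb).1, fun a ha => ?_⟩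
    obtain ⟨haV, hua⟩ := Finset.mem_filter.1 ha
    obtain ⟨w, hw, hwa, hs⟩ := h1.2 a haV
    exact ⟨w, Finset.mem_filter.2 ⟨hw, hua.tail ⟨haV, hw, Or.inl hwa.symm⟩⟩, hwa, hs⟩
  · refine longitudeOK_iff.2 ⟨fun a ha b hb => h2.1 a (Finset.mem_filter.1 ha).1 b
      (Finset.mem_filter.1 hb).1, fun a ha => ?_⟩
    obtain ⟨haV, hua⟩ := Finset.mem_filter.1 ha
    obtain ⟨w, hw, hwa, hs⟩ := h2.2 a haV
    exact ⟨w, Finset.mem_filter.2 ⟨hw, hua.tail ⟨haV, hw, Or.inr hwa.symm⟩⟩, hwa, hs⟩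

lemma mem_of_conn {V S : Finset Torus} {sgn : Torus → Bool} (hV : IsDiagSet V sgn) (hSV : S ⊆ V)
    (hS : IsDiagSet S sgn) {u w : Torus} (hu : u ∈ S) (h : Conn V u w) : w ∈ S := by
  induction h with
  | refl => exact hu
  | @tail a b _ hab ih =>
    obtain ⟨haV, hbV, hab⟩ := hab
    by_cases hs : sgn a = sgn b
    · rwa [← hV.eq_of_aligned haV hbV hab hs]
    · rcases hab with hab | hab
      · obtain ⟨c, hc, hca, hsc⟩ := (meridianOK_iff.1 hS.1).2 a ih
        have : b = c := hV.eq_of_aligned hbV (hSV hc) (Or.inl (hab.symm.trans hca.symm))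
          (by revert hs hsc; cases sgn a <;> cases sgn b <;> cases sgn c <;> simp)
        rwa [this]
      · obtain ⟨c, hc, hca, hsc⟩ := (longitudeOK_iff.1 hS.2).2 a ih
        have : b = c := hV.eq_of_aligned hbV (hSV hc) (Or.inr (hab.symm.trans hca.symm))
          (by revert hs hsc; cases sgn a <;> cases sgn b <;> cases sgn c <;> simp)
        rwa [this]

lemma exists_isComponent_iff {V : Finset Torus} {sgn : Torus → Bool} (hV : IsDiagSet V sgn)
    {u v : Torus} (hu : u ∈ V) :
    (∃ S, IsComponent V sgn S ∧ u ∈ S ∧ v ∈ S) ↔ Conn V u v := by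
  classical
  constructor
  · rintro ⟨S, ⟨hSV, -, hS, hmin⟩, huS, hvS⟩
    have : {w ∈ V | Conn V u w} = S := by
      refine hmin _ (fun w hw => mem_of_conn hV hSV hS huS (Finset.mem_filter.1 hw).2)
        ⟨u, Finset.mem_filter.2 ⟨hu, .refl⟩⟩ (isDiagSet_conn hV u)
    rw [← this] at hvS
    exact (Finset.mem_filter.1 hvS).2
  · intro h
    refine ⟨{w ∈ V | Conn V u w}, ⟨Finset.filter_subset _ _,
      ⟨u, Finset.mem_filter.2 ⟨hu, .refl⟩⟩, isDiagSet_conn hV u, fun S hS hne hd => ?_⟩,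
      Finset.mem_filter.2 ⟨hu, .refl⟩, Finset.mem_filter.2 ⟨h.mem hu, h⟩⟩
    refine hS.antisymm fun w hw => ?_
    obtain ⟨a, ha⟩ := hne
    have hua := (Finset.mem_filter.1 (hS ha)).2
    exact mem_of_conn hV (hS.trans (Finset.filter_subset _ _)) hd ha
      (hua.symm.trans (Finset.mem_filter.1 hw).2)

namespace RectDiagram

lemma comp_eq_iff_conn (R : RectDiagram) {u v : Torus} (hu : u ∈ R.verts) (hv : v ∈ R.verts) :
    R.comp u = R.comp v ↔ Conn R.verts u v :=
  (R.comp_eq_iff u hu v hv).trans (exists_isComponent_iff R.diag hu)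

lemma comp_eq_of_aligned (R : RectDiagram) {u v : Torus} (hu : u ∈ R.verts) (hv : v ∈ R.verts)
    (h : Aligned u v) : R.comp u = R.comp v :=
  (R.comp_eq_iff_conn hu hv).2 (.single ⟨hu, hv, h⟩)

lemma sgn_eq_not (R : RectDiagram) {u v : Torus} (hu : u ∈ R.verts) (hv : v ∈ R.verts)
    (h : Aligned u v) (hne : u ≠ v) : R.sgn v = !R.sgn u := by
  have : R.sgn u ≠ R.sgn v := fun hs => hne (R.diag.eq_of_aligned hu hv h hs)
  revert this
  cases R.sgn u <;> cases R.sgn v <;> simp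

lemma exists_fst_eq (R : RectDiagram) {u : Torus} (hu : u ∈ R.verts) :
    ∃ w ∈ R.verts, w.1 = u.1 ∧ w ≠ u := by
  obtain ⟨w, hw, h, hs⟩ := (meridianOK_iff.1 R.diag.1).2 u hu
  exact ⟨w, hw, h, fun h => hs (by rw [h])⟩

lemma exists_snd_eq (R : RectDiagram) {u : Torus} (hu : u ∈ R.verts) :
    ∃ w ∈ R.verts, w.2 = u.2 ∧ w ≠ u := by
  obtain ⟨w, hw, h, hs⟩ := (longitudeOK_iff.1 R.diag.2).2 u hu
  exact ⟨w, hw, h, fun h => hs (by rw [h])⟩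

lemma eq_or_eq_of_fst_eq (R : RectDiagram) {a b c : Torus} (ha : a ∈ R.verts) (hb : b ∈ R.verts)
    (hc : c ∈ R.verts) (hac : a ≠ b) (hab : a.1 = b.1) (hcb : c.1 = b.1) : c = a ∨ c = b := by
  by_contra! h
  have h1 := R.sgn_eq_not ha hb (Or.inl hab) hac
  have h2 := R.sgn_eq_not hc hb (Or.inl hcb) h.2
  have h3 := R.sgn_eq_not hc ha (Or.inl (hcb.trans hab.symm)) h.1
  grind

lemma eq_or_eq_of_snd_eq (R : RectDiagram) {a b c : Torus} (ha : a ∈ R.verts) (hb : b ∈ R.verts)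
    (hc : c ∈ R.verts) (hac : a ≠ b) (hab : a.2 = b.2) (hcb : c.2 = b.2) : c = a ∨ c = b := by
  by_contra! h
  have h1 := R.sgn_eq_not ha hb (Or.inr hab) hac
  have h2 := R.sgn_eq_not hc hb (Or.inr hcb) h.2
  have h3 := R.sgn_eq_not hc ha (Or.inr (hcb.trans hab.symm)) h.1
  grind

/-- A diagram from a vertex set satisfying the meridian and longitude conditions pointwise,
whose numbering agrees with connectivity. -/
def ofConn (V : Finset Torus) (sgn : Torus → Bool) (comp : Torus → ℕ)
    (h1 : ∀ a ∈ V, ∀ b ∈ V, Aligned a b → sgn a = sgn b → a = b)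
    (h2 : ∀ u ∈ V, (∃ w ∈ V, w.1 = u.1 ∧ sgn w ≠ sgn u) ∧ ∃ w ∈ V, w.2 = u.2 ∧ sgn w ≠ sgn u)
    (h3 : ∀ a ∈ V, ∀ b ∈ V, Aligned a b → comp a = comp b)
    (h4 : ∀ a ∈ V, ∀ b ∈ V, comp a = comp b → Conn V a b) : RectDiagram where
  verts := V
  sgn := sgn
  comp := comp
  diag := ⟨meridianOK_iff.2 ⟨fun a ha b hb h => h1 a ha b hb (Or.inl h), fun u hu => (h2 u hu).1⟩,
    longitudeOK_iff.2 ⟨fun a ha b hb h => h1 a ha b hb (Or.inr h), fun u hu => (h2 u hu).2⟩⟩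
  comp_eq_iff u hu v hv := by
    rw [exists_isComponent_iff ⟨meridianOK_iff.2 ⟨fun a ha b hb h => h1 a ha b hb (Or.inl h),
      fun u hu => (h2 u hu).1⟩, longitudeOK_iff.2 ⟨fun a ha b hb h => h1 a ha b hb (Or.inr h),
      fun u hu => (h2 u hu).2⟩⟩ hu]
    refine ⟨h4 u hu v hv, fun h => ?_⟩
    clear hv
    induction h with
    | refl => rfl
    | tail _ hab ih => exact ih.trans (h3 _ hab.1 _ hab.2.1 hab.2.2)

/-- The image of a diagram under a bijection of the torus preserving alignment. -/
def map (R : RectDiagram) (e : Torus ≃ Torus)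
    (he : (∀ p q, ((e p).1 = (e q).1 ↔ p.1 = q.1) ∧ ((e p).2 = (e q).2 ↔ p.2 = q.2)) ∨
      ∀ p q, ((e p).1 = (e q).1 ↔ p.2 = q.2) ∧ ((e p).2 = (e q).2 ↔ p.1 = q.1)) :
    RectDiagram :=
  have hal : ∀ p q, Aligned (e p) (e q) ↔ Aligned p q := fun p q => by
    unfold Aligned
    rcases he with he | he
    · rw [(he p q).1, (he p q).2]
    · rw [(he p q).1, (he p q).2, or_comm]
  ofConn (R.verts.map e.toEmbedding) (R.sgn ∘ e.symm) (R.comp ∘ e.symm)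
    (by
      intro a ha' b hb' hab hs
      obtain ⟨a, ha, rfl⟩ := Finset.mem_map.1 ha'
      obtain ⟨b, hb, rfl⟩ := Finset.mem_map.1 hb'
      simp only [Function.comp, Equiv.coe_toEmbedding, Equiv.symm_apply_apply] at hs hab ⊢
      rw [R.diag.eq_of_aligned ha hb ((hal a b).1 hab) hs])
    (by
      intro u hu'
      obtain ⟨u, hu, rfl⟩ := Finset.mem_map.1 hu'
      obtain ⟨w, hw, h, hs⟩ := (meridianOK_iff.1 R.diag.1).2 u hu
      obtain ⟨w', hw', h', hs'⟩ := (longitudeOK_iff.1 R.diag.2).2 u hu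
      rcases he with he | he
      · exact ⟨⟨e w, by simpa using hw, (he w u).1.2 h, by simpa using hs⟩,
          e w', by simpa using hw', (he w' u).2.2 h', by simpa using hs'⟩
      · exact ⟨⟨e w', by simpa using hw', (he w' u).1.2 h', by simpa using hs'⟩,
          e w, by simpa using hw, (he w u).2.2 h, by simpa using hs⟩)
    (by
      intro a ha' b hb' hab
      obtain ⟨a, ha, rfl⟩ := Finset.mem_map.1 ha'
      obtain ⟨b, hb, rfl⟩ := Finset.mem_map.1 hb'
      simpa using R.comp_eq_of_aligned ha hb ((hal a b).1 hab))
    (by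
      intro a ha' b hb' hab
      obtain ⟨a, ha, rfl⟩ := Finset.mem_map.1 ha'
      obtain ⟨b, hb, rfl⟩ := Finset.mem_map.1 hb'
      simp only [Function.comp, Equiv.coe_toEmbedding, Equiv.symm_apply_apply] at hab ⊢
      exact Relation.ReflTransGen.lift e (fun c d h => ⟨by simpa using h.1, by simpa using h.2.1,
        (hal c d).2 h.2.2⟩) _ _ ((R.comp_eq_iff_conn ha hb).1 hab))

/-- The diagram obtained by exchanging the two coordinates of the torus. -/
def transpose (R : RectDiagram) : RectDiagram :=
  R.map (Equiv.prodComm _ _) (Or.inr fun _ _ => ⟨Iff.rfl, Iff.rfl⟩)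

@[simp] lemma mem_transpose_verts {R : RectDiagram} {p : Torus} :
    p ∈ R.transpose.verts ↔ p.swap ∈ R.verts := by
  simp [transpose, map, ofConn, Finset.mem_map_equiv]

@[simp] lemma transpose_transpose (R : RectDiagram) : R.transpose.transpose = R := by
  have h : R.transpose.transpose.verts = R.verts := by ext p; simp
  obtain ⟨V, s, c, h1, h2⟩ := R
  simp only [transpose, map, ofConn] at h ⊢
  congr 1

end RectDiagram

/-- `S` is obtained from `R` by a stabilization at the vertex `v` that introduces the meridian `a`
and the longitude `c`; the booleans tell in which directions the rectangle extends from `v`. -/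
structure StabAt (R : RectDiagram) (v : Torus) (a c : Real.Angle) (dx dy : Bool)
    (S : RectDiagram) : Prop where
  mem : v ∈ R.verts
  fst_ne : ∀ p ∈ R.verts, p.1 ≠ a
  snd_ne : ∀ p ∈ R.verts, p.2 ≠ c
  box : ∀ p ∈ R.verts, p.1 ∈ DArc dx v.1 a → p.2 ∈ DArc dy v.2 c → p = v
  mem_iff : ∀ p, p ∈ S.verts ↔ (p ∈ R.verts ∧ p ≠ v) ∨ p = (a, v.2) ∨ p = (v.1, c) ∨ p = (a, c)
  sgn_old : ∀ p ∈ R.verts, p ≠ v → S.sgn p = R.sgn p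
  comp_old : ∀ p ∈ R.verts, p ≠ v → S.comp p = R.comp p
  sgn_fst : S.sgn (a, v.2) = R.sgn v
  sgn_snd : S.sgn (v.1, c) = R.sgn v
  sgn_opp : S.sgn (a, c) = !R.sgn v
  comp_fst : S.comp (a, v.2) = R.comp v
  comp_snd : S.comp (v.1, c) = R.comp v
  comp_opp : S.comp (a, c) = R.comp v

lemma exists_stabAt (R : RectDiagram) {v : Torus} {a c : Real.Angle} {dx dy : Bool}
    (hv : v ∈ R.verts) (ha : ∀ p ∈ R.verts, p.1 ≠ a) (hc : ∀ p ∈ R.verts, p.2 ≠ c)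
    (hbox : ∀ p ∈ R.verts, p.1 ∈ DArc dx v.1 a → p.2 ∈ DArc dy v.2 c → p = v) :
    ∃ S, StabAt R v a c dx dy S := by
  obtain ⟨x, y⟩ := v
  have hxa : x ≠ a := ha _ hv
  have hyc : y ≠ c := hc _ hv
  have hfst : ∀ p ∈ R.verts, p ≠ (x, y) → p.1 = x → R.sgn p = !R.sgn (x, y) := fun p hp hne h =>
    R.sgn_eq_not hv hp (Or.inl h.symm) hne.symm
  have hsnd : ∀ p ∈ R.verts, p ≠ (x, y) → p.2 = y → R.sgn p = !R.sgn (x, y) := fun p hp hne h =>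
    R.sgn_eq_not hv hp (Or.inr h.symm) hne.symm
  let V : Finset Torus := insert (a, y) (insert (x, c) (insert (a, c) (R.verts.erase (x, y))))
  let sgn : Torus → Bool := fun p => if p.1 = a ∧ p.2 = c then !R.sgn (x, y) else
    if p.1 = a ∨ p.2 = c then R.sgn (x, y) else R.sgn p
  let comp : Torus → ℕ := fun p => if p.1 = a ∨ p.2 = c then R.comp (x, y) else R.comp p
  have hV : ∀ p, p ∈ V ↔ (p ∈ R.verts ∧ p ≠ (x, y)) ∨ p = (a, y) ∨ p = (x, c) ∨ p = (a, c) := by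
    intro p
    simp only [V, Finset.mem_insert, Finset.mem_erase]
    tauto
  have sold : ∀ p ∈ R.verts, sgn p = R.sgn p := fun p hp => by
    simp [sgn, ha p hp, hc p hp]
  have cold : ∀ p ∈ R.verts, comp p = R.comp p := fun p hp => by
    simp [comp, ha p hp, hc p hp]
  have s1 : sgn (a, y) = R.sgn (x, y) := by simp [sgn, hyc]
  have s2 : sgn (x, c) = R.sgn (x, y) := by simp [sgn, hxa]
  have s3 : sgn (a, c) = !R.sgn (x, y) := by simp [sgn]
  have c1 : comp (a, y) = R.comp (x, y) := by simp [comp]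
  have c2 : comp (x, c) = R.comp (x, y) := by simp [comp]
  have c3 : comp (a, c) = R.comp (x, y) := by simp [comp]
  have hne : ∀ b : Bool, b ≠ !b := by decide
  have h1 : ∀ p ∈ V, ∀ q ∈ V, Aligned p q → sgn p = sgn q → p = q := by
    intro p hp q hq hpq hs
    have hold : p ∈ R.verts → q ∈ R.verts → p = q := fun hp hq => by
      rw [sold p hp, sold q hq] at hs
      exact R.diag.eq_of_aligned hp hq hpq hs
    rw [hV] at hp hq
    unfold Aligned at hpq
    clear_value V sgn comp
    grind
  have h2 : ∀ u ∈ V, (∃ w ∈ V, w.1 = u.1 ∧ sgn w ≠ sgn u) ∧ ∃ w ∈ V, w.2 = u.2 ∧ sgn w ≠ sgn u := by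
    intro u hu
    have m1 : (a, y) ∈ V := (hV _).2 (by simp)
    have m2 : (x, c) ∈ V := (hV _).2 (by simp)
    have m3 : (a, c) ∈ V := (hV _).2 (by simp)
    rcases (hV u).1 hu with ⟨huR, hne'⟩ | rfl | rfl | rfl
    · constructor
      · by_cases hx : u.1 = x
        · exact ⟨_, m2, hx.symm, by rw [s2, sold u huR, hfst u huR hne' hx]; exact hne _⟩
        · obtain ⟨w, hw, hwu, hwne⟩ := R.exists_fst_eq huR
          refine ⟨w, (hV w).2 (Or.inl ⟨hw, fun h => hx (by rw [← hwu, h])⟩), hwu, ?_⟩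
          rw [sold w hw, sold u huR, R.sgn_eq_not huR hw (Or.inl hwu.symm) hwne.symm]
          exact (hne _).symm
      · by_cases hy : u.2 = y
        · exact ⟨_, m1, hy.symm, by rw [s1, sold u huR, hsnd u huR hne' hy]; exact hne _⟩
        · obtain ⟨w, hw, hwu, hwne⟩ := R.exists_snd_eq huR
          refine ⟨w, (hV w).2 (Or.inl ⟨hw, fun h => hy (by rw [← hwu, h])⟩), hwu, ?_⟩
          rw [sold w hw, sold u huR, R.sgn_eq_not huR hw (Or.inr hwu.symm) hwne.symm]
          exact (hne _).symm
    · refine ⟨⟨_, m3, rfl, by rw [s3, s1]; exact (hne _).symm⟩, ?_⟩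
      obtain ⟨w, hw, hwu, hwne⟩ := R.exists_snd_eq hv
      refine ⟨w, (hV w).2 (Or.inl ⟨hw, hwne⟩), hwu, ?_⟩
      rw [sold w hw, s1, hsnd w hw hwne hwu]
      exact (hne _).symm
    · refine ⟨?_, ⟨_, m3, rfl, by rw [s3, s2]; exact (hne _).symm⟩⟩
      obtain ⟨w, hw, hwu, hwne⟩ := R.exists_fst_eq hv
      refine ⟨w, (hV w).2 (Or.inl ⟨hw, hwne⟩), hwu, ?_⟩
      rw [sold w hw, s2, hfst w hw hwne hwu]
      exact (hne _).symm
    · exact ⟨⟨_, m1, rfl, by rw [s3, s1]; exact hne _⟩, ⟨_, m2, rfl, by rw [s3, s2]; exact hne _⟩⟩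
  have h3 : ∀ p ∈ V, ∀ q ∈ V, Aligned p q → comp p = comp q := by
    intro p hp q hq hpq
    have hold : p ∈ R.verts → q ∈ R.verts → comp p = comp q := fun hp hq => by
      rw [cold p hp, cold q hq]
      exact R.comp_eq_of_aligned hp hq hpq
    have hvc : ∀ p ∈ R.verts, p.1 = x ∨ p.2 = y → comp p = R.comp (x, y) := fun p hp h => by
      rw [cold p hp]
      exact R.comp_eq_of_aligned hp hv h
    rw [hV] at hp hq
    unfold Aligned at hpq
    clear_value V sgn comp
    grind
  have h4 : ∀ p ∈ V, ∀ q ∈ V, comp p = comp q → Conn V p q := by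
    have m1 : (a, y) ∈ V := (hV _).2 (by simp)
    have m2 : (x, c) ∈ V := (hV _).2 (by simp)
    have m3 : (a, c) ∈ V := (hV _).2 (by simp)
    let f : Torus → Torus := fun p => if p = (x, y) then (a, c) else p
    let g : Torus → Torus := fun p => if p.1 = a ∨ p.2 = c then (x, y) else p
    have hg : ∀ p ∈ V, g p ∈ R.verts ∧ comp p = R.comp (g p) := by
      intro p hp
      rcases (hV p).1 hp with ⟨hp, -⟩ | rfl | rfl | rfl
      · simp [g, ha p hp, hc p hp, hp, cold]
      all_goals simp [g, hv, c1, c2, c3]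
    have c13 : Conn V (a, y) (a, c) := .single ⟨m1, m3, Or.inl rfl⟩
    have c23 : Conn V (x, c) (a, c) := .single ⟨m2, m3, Or.inr rfl⟩
    have hfg : ∀ p ∈ V, Conn V p (f (g p)) := by
      intro p hp
      rcases (hV p).1 hp with ⟨hp, hne⟩ | rfl | rfl | rfl
      · simp only [f, g, ha p hp, hc p hp, or_self, if_false, hne]
        exact .refl
      · simpa [f, g] using c13
      · simpa [f, g] using c23
      · simp only [f, g, true_or, if_true]
        exact .refl
    have hout : ∀ p ∈ R.verts, p ≠ (x, y) → Aligned p (x, y) → Conn V p (a, c) := by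
      intro p hp hne h
      have hpV : p ∈ V := (hV p).2 (Or.inl ⟨hp, hne⟩)
      rcases h with h | h
      · exact .head ⟨hpV, m2, Or.inl h⟩ c23
      · exact .head ⟨hpV, m1, Or.inr h⟩ c13
    have hf : ∀ p q, Conn R.verts p q → Conn V (f p) (f q) := by
      intro p q h
      induction h with
      | refl => exact .refl
      | @tail s t _ hst ih =>
        obtain ⟨hs, ht, hst⟩ := hst
        refine ih.trans ?_
        by_cases h1 : s = (x, y) <;> by_cases h2 : t = (x, y)
        · subst h1; subst h2; exact .refl
        · simp only [f, h1, h2, if_true, if_false]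
          subst h1
          exact (hout t ht h2 hst.symm).symm
        · simp only [f, h1, h2, if_true, if_false]
          subst h2
          exact hout s hs h1 hst
        · simp only [f, h1, h2, if_false]
          exact .single ⟨(hV s).2 (Or.inl ⟨hs, h1⟩), (hV t).2 (Or.inl ⟨ht, h2⟩), hst⟩
    intro p hp q hq hpq
    rw [(hg p hp).2, (hg q hq).2, R.comp_eq_iff_conn (hg p hp).1 (hg q hq).1] at hpq
    exact (hfg p hp).trans ((hf _ _ hpq).trans (hfg q hq).symm)
  exact ⟨RectDiagram.ofConn V sgn comp h1 h2 h3 h4, hv, ha, hc, hbox, hV,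
    fun p hp _ => sold p hp, fun p hp _ => cold p hp, s1, s2, s3, c1, c2, c3⟩

/-- The oriented type of a stabilization at a vertex of sign `e`, whose rectangle extends from the
vertex in the directions `dx` and `dy`. -/
def OType.ofDirs (dx dy e : Bool) : OType :=
  if dx = dy then (if e = dx then .negI else .posI) else (if e = dx then .negII else .posII)

lemma OType.ofDirs_not (dx dy e : Bool) : ofDirs (!dx) (!dy) (!e) = ofDirs dx dy e := by
  revert dx dy e; decide

lemma OType.ofDirs_injective {dx dy dx' dy' e : Bool} (h : ofDirs dx dy e = ofDirs dx' dy' e) :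
    dx = dx' ∧ dy = dy' := by
  revert dx dy dx' dy' e; decide

lemma OType.exists_ofDirs (t : OType) (e : Bool) : ∃ dx dy, ofDirs dx dy e = t := by
  cases t <;> cases e <;> decide

lemma mem_corners {t1 t2 p1 p2 : Real.Angle} {p : Torus} :
    p ∈ corners t1 t2 p1 p2 ↔ (p.1 = t1 ∨ p.1 = t2) ∧ (p.2 = p1 ∨ p.2 = p2) := by
  obtain ⟨a, b⟩ := p
  simp only [corners, Finset.mem_insert, Finset.mem_singleton, Prod.mk.injEq]
  tauto

lemma card_corners {t1 t2 p1 p2 : Real.Angle} (ht : t1 ≠ t2) (hp : p1 ≠ p2) :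
    (corners t1 t2 p1 p2).card = 4 := by
  have h : corners t1 t2 p1 p2 = ({t1, t2} : Finset Real.Angle) ×ˢ {p1, p2} := by
    ext p
    simp [mem_corners]
  rw [h, Finset.card_product, Finset.card_pair ht, Finset.card_pair hp]

lemma isElemMoveWith_of_dirs {R S : RectDiagram} {x a y c : Real.Angle} (dx dy : Bool)
    (hxa : x ≠ a) (hyc : y ≠ c)
    (hsd : ∀ p, ((p ∈ R.verts ∧ p ∉ S.verts) ∨ (p ∈ S.verts ∧ p ∉ R.verts)) ↔
      (p.1 = x ∨ p.1 = a) ∧ (p.2 = y ∨ p.2 = c))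
    (hedge : ∃ u v : Torus, u ∈ symmDiff R.verts S.verts ∧ v ∈ symmDiff R.verts S.verts ∧
      (IsEdge R u v ∨ IsEdge S u v))
    (hRS : ∃ p ∈ R.verts, p ∉ S.verts) (hSR : ∃ p ∈ S.verts, p ∉ R.verts)
    (hbox : ∀ p, p ∈ R.verts ∨ p ∈ S.verts → p.1 ∈ DArc dx x a → p.2 ∈ DArc dy y c →
      (p.1 = x ∨ p.1 = a) ∧ (p.2 = y ∨ p.2 = c))
    (hsgn : ∀ p ∈ R.verts, p ∈ S.verts → R.sgn p = S.sgn p)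
    (hcomp : ∀ p ∈ R.verts, p ∈ S.verts → R.comp p = S.comp p) :
    IsElemMoveWith R S (if dx then x else a) (if dx then a else x) (if dy then y else c)
      (if dy then c else y) := by
  have hc : ∀ p : Torus, p ∈ corners (if dx then x else a) (if dx then a else x)
      (if dy then y else c) (if dy then c else y) ↔
        (p.1 = x ∨ p.1 = a) ∧ (p.2 = y ∨ p.2 = c) := by
    intro p
    rw [mem_corners]
    cases dx <;> cases dy <;> grind
  have hr : ∀ p : Torus, p ∈ RectSet (if dx then x else a) (if dx then a else x)
      (if dy then y else c) (if dy then c else y) ↔ p.1 ∈ DArc dx x a ∧ p.2 ∈ DArc dy y c := by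
    intro p
    cases dx <;> cases dy <;> simp [RectSet, DArc]
  refine ⟨by cases dx <;> simp [hxa, hxa.symm], by cases dy <;> simp [hyc, hyc.symm], ?_, hedge,
    fun h => ?_, fun h => ?_, ?_, fun p hp => ?_⟩
  · ext p
    rw [Finset.mem_symmDiff, hc, hsd]
  · obtain ⟨p, hp, hp'⟩ := hRS
    exact hp' (h hp)
  · obtain ⟨p, hp, hp'⟩ := hSR
    exact hp' (h hp)
  · ext p
    rw [Finset.mem_coe, hc, Set.mem_inter_iff, hr]
    constructor
    · rintro ⟨⟨h1, h2⟩, h3⟩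
      exact hbox p (by simpa using h3) h1 h2
    · intro h
      refine ⟨⟨?_, ?_⟩, ?_⟩
      · rcases h.1 with h | h <;> simp [h]
      · rcases h.2 with h | h <;> simp [h]
      · rcases (hsd p).2 h with h | h
        · exact Or.inl h.1
        · exact Or.inr h.1
  · rw [Finset.mem_inter] at hp
    exact ⟨hsgn p hp.1 hp.2, hcomp p hp.1 hp.2⟩

namespace StabAt

variable {R S : RectDiagram} {v : Torus} {a c : Real.Angle} {dx dy : Bool}

lemma fst_ne' (h : StabAt R v a c dx dy S) : v.1 ≠ a := h.fst_ne v h.mem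

lemma snd_ne' (h : StabAt R v a c dx dy S) : v.2 ≠ c := h.snd_ne v h.mem

lemma verts_eq (h : StabAt R v a c dx dy S) :
    S.verts = insert (a, v.2) (insert (v.1, c) (insert (a, c) (R.verts.erase v))) := by
  ext p
  rw [h.mem_iff]
  simp only [Finset.mem_insert, Finset.mem_erase]
  tauto

lemma card_eq (h : StabAt R v a c dx dy S) : S.verts.card = R.verts.card + 2 := by
  have h1 := h.fst_ne'
  have h2 := h.snd_ne'
  have n1 : (a, v.2) ∉ R.verts := fun h' => h.fst_ne _ h' rfl
  have n2 : (v.1, c) ∉ R.verts := fun h' => h.snd_ne _ h' rfl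
  have n3 : (a, c) ∉ R.verts := fun h' => h.fst_ne _ h' rfl
  rw [h.verts_eq, Finset.card_insert_of_notMem, Finset.card_insert_of_notMem,
    Finset.card_insert_of_notMem, Finset.card_erase_of_mem h.mem]
  · have := Finset.card_pos.2 ⟨v, h.mem⟩
    omega
  · simp [n3]
  · simp [n2, h1]
  · simp [n1, h1.symm, h2]

lemma fst_mem (h : StabAt R v a c dx dy S) : (a, v.2) ∈ S.verts := (h.mem_iff _).2 (by simp)

lemma snd_mem (h : StabAt R v a c dx dy S) : (v.1, c) ∈ S.verts := (h.mem_iff _).2 (by simp)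

lemma opp_mem (h : StabAt R v a c dx dy S) : (a, c) ∈ S.verts := (h.mem_iff _).2 (by simp)

lemma notMem (h : StabAt R v a c dx dy S) : v ∉ S.verts := by
  have h1 := h.fst_ne'
  have h2 := h.snd_ne'
  obtain ⟨x, y⟩ := v
  simp only at h1 h2
  simp [h.mem_iff, h1, h2]

lemma isStabWith (h : StabAt R v a c dx dy S) :
    IsStabWith R S (if dx then v.1 else a) (if dx then a else v.1) (if dy then v.2 else c)
      (if dy then c else v.2) := by
  have h1 := h.fst_ne'
  have h2 := h.snd_ne'
  have n1 : (a, v.2) ∉ R.verts := fun h' => h.fst_ne _ h' rfl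
  have n2 : (v.1, c) ∉ R.verts := fun h' => h.snd_ne _ h' rfl
  have n3 : (a, c) ∉ R.verts := fun h' => h.fst_ne _ h' rfl
  have hv := h.mem
  have hv' := h.notMem
  have hmem := h.mem_iff
  refine ⟨isElemMoveWith_of_dirs dx dy h1 h2 ?_ ?_ ⟨v, hv, hv'⟩ ⟨_, h.fst_mem, n1⟩ ?_ ?_ ?_,
    h.card_eq⟩
  · rintro ⟨p, q⟩
    obtain ⟨x, y⟩ := v
    simp only [hmem, Prod.mk.injEq, ne_eq] at *
    have f1 := h.fst_ne (p, q)
    have f2 := h.snd_ne (p, q)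
    simp only at f1 f2
    clear hmem h
    constructor
    · grind
    · rintro ⟨rfl | rfl, rfl | rfl⟩ <;> simp_all
  · refine ⟨(a, v.2), (a, c), ?_, ?_, Or.inr ⟨h.fst_mem, h.opp_mem, ?_, Or.inl rfl⟩⟩
    · exact Finset.mem_symmDiff.2 (Or.inr ⟨h.fst_mem, n1⟩)
    · exact Finset.mem_symmDiff.2 (Or.inr ⟨h.opp_mem, n3⟩)
    · simpa using h2
  · intro p hp q1 q2
    rcases hp with hp | hp
    · rw [h.box p hp q1 q2]
      simp
    · rcases (hmem p).1 hp with hp | rfl | rfl | rfl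
      · rw [h.box p hp.1 q1 q2]
        simp
      all_goals simp
  · intro p hp hp'
    exact (h.sgn_old p hp fun e => hv' (e ▸ hp')).symm
  · intro p hp hp'
    exact (h.comp_old p hp fun e => hv' (e ▸ hp')).symm

lemma isStabOfOType (h : StabAt R v a c dx dy S) :
    IsStabOfOType R S (OType.ofDirs dx dy (R.sgn v)) := by
  have h1 := h.fst_ne'
  have h2 := h.snd_ne'
  have hcor : ∀ p ∈ R.verts, (p.1 = v.1 ∨ p.1 = a) → (p.2 = v.2 ∨ p.2 = c) → p = v := by
    intro p hp e1 e2
    exact Prod.ext (e1.resolve_right (h.fst_ne p hp)) (e2.resolve_right (h.snd_ne p hp))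
  refine ⟨_, _, _, _, h.isStabWith, c, by cases dy <;> simp, ?_, ?_, ?_⟩
  · cases dx
    · simpa using h.opp_mem
    · simpa using h.snd_mem
  · cases dx
    · simpa using h.snd_mem
    · simpa using h.opp_mem
  · have s1 := h.sgn_snd
    have s2 := h.sgn_opp
    cases hs : R.sgn v <;> rw [hs] at s1 s2 <;> cases dx <;> cases dy <;>
      simp only [OType.ofDirs, TypeICornerCond, TypeIICornerCond, mem_corners, if_true, if_false,
        Bool.false_eq_true, reduceCtorEq, s1, s2, Bool.not_true, Bool.not_false, and_true] <;>
      · intro p hp hpc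
        have := hcor p hp (by tauto) (by tauto)
        simp [this]

lemma modifiesComp_iff (h : StabAt R v a c dx dy S) {i : ℕ} :
    ModifiesComp R S i ↔ R.comp v = i := by
  constructor
  · rintro ⟨w, hw, hw', rfl⟩
    by_cases e : w = v
    · rw [e]
    · exact absurd ((h.mem_iff w).2 (Or.inl ⟨hw, e⟩)) hw'
  · rintro rfl
    exact ⟨v, h.mem, h.notMem, rfl⟩

lemma modifiesComp_symm_iff (h : StabAt R v a c dx dy S) {i : ℕ} :
    ModifiesComp S R i ↔ R.comp v = i := by
  constructor
  · rintro ⟨w, hw, hw', rfl⟩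
    rcases (h.mem_iff w).1 hw with hw | rfl | rfl | rfl
    · exact absurd hw.1 hw'
    · exact h.comp_fst.symm
    · exact h.comp_snd.symm
    · exact h.comp_opp.symm
  · rintro rfl
    exact ⟨_, h.fst_mem, fun h' => h.fst_ne _ h' rfl, h.comp_fst⟩

end StabAt

lemma card_sdiff_of_isStabWith {R S : RectDiagram} {t1 t2 p1 p2 : Real.Angle}
    (h : IsStabWith R S t1 t2 p1 p2) : (R.verts \ S.verts).card = 1 := by
  have h1 : (symmDiff R.verts S.verts).card = 4 := by
    rw [h.1.2.2.1, card_corners h.1.1 h.1.2.1]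
  rw [symmDiff_def, Finset.sup_eq_union, Finset.card_union_of_disjoint disjoint_sdiff_sdiff] at h1
  have h2 := Finset.card_sdiff_add_card_inter R.verts S.verts
  have h3 := Finset.card_sdiff_add_card_inter S.verts R.verts
  rw [Finset.inter_comm] at h3
  have h4 := h.2
  omega

lemma stabAt_of_mem {R S : RectDiagram} {x a y c : Real.Angle} {dx dy : Bool}
    (hxa : x ≠ a) (hyc : y ≠ c)
    (hsd : ∀ p, ((p ∈ R.verts ∧ p ∉ S.verts) ∨ (p ∈ S.verts ∧ p ∉ R.verts)) ↔
      (p.1 = x ∨ p.1 = a) ∧ (p.2 = y ∨ p.2 = c))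
    (hR : ∀ p, p ∈ R.verts ∧ p ∉ S.verts ↔ p = (x, y))
    (hbox : ∀ p, p ∈ R.verts → p.1 ∈ DArc dx x a → p.2 ∈ DArc dy y c →
      (p.1 = x ∨ p.1 = a) ∧ (p.2 = y ∨ p.2 = c))
    (hold : ∀ p ∈ R.verts, p ∈ S.verts → R.sgn p = S.sgn p ∧ R.comp p = S.comp p) :
    StabAt R (x, y) a c dx dy S := by
  have hv := (hR (x, y)).2 rfl
  have key : ∀ p : Torus, (p.1 = x ∨ p.1 = a) ∧ (p.2 = y ∨ p.2 = c) → p ≠ (x, y) →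
      p ∈ S.verts ∧ p ∉ R.verts := fun p hp hne =>
    ((hsd p).2 hp).resolve_left fun h => hne ((hR p).1 h)
  have k1 := key (a, y) (by simp) (by simp [hxa.symm])
  have k2 := key (x, c) (by simp) (by simp [hyc.symm])
  have k3 := key (a, c) (by simp) (by simp [hxa.symm])
  have hS : ∀ p ∈ R.verts, p ≠ (x, y) → p ∈ S.verts := fun p hp hne => by
    by_contra h
    exact hne ((hR p).1 ⟨hp, h⟩)
  obtain ⟨w, hw, hw1, hwne⟩ := R.exists_fst_eq hv.1
  obtain ⟨u, hu, hu1, hune⟩ := R.exists_snd_eq hv.1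
  have hwS := hS w hw hwne
  have huS := hS u hu hune
  have wx : w ≠ (x, c) := fun h => k2.2 (h ▸ hw)
  have ua : u ≠ (a, y) := fun h => k1.2 (h ▸ hu)
  have sw := R.sgn_eq_not hv.1 hw (Or.inl hw1.symm) hwne.symm
  have su := R.sgn_eq_not hv.1 hu (Or.inr hu1.symm) hune.symm
  have cw := R.comp_eq_of_aligned hv.1 hw (Or.inl hw1.symm)
  have cu := R.comp_eq_of_aligned hv.1 hu (Or.inr hu1.symm)
  have s1 : S.sgn (a, y) = R.sgn (x, y) := by
    rw [S.sgn_eq_not huS k1.1 (Or.inr hu1) ua, ← (hold u hu huS).1, su, Bool.not_not]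
  have s2 : S.sgn (x, c) = R.sgn (x, y) := by
    rw [S.sgn_eq_not hwS k2.1 (Or.inl hw1) wx, ← (hold w hw hwS).1, sw, Bool.not_not]
  have c1 : S.comp (a, y) = R.comp (x, y) := by
    rw [cu, (hold u hu huS).2, S.comp_eq_of_aligned huS k1.1 (Or.inr hu1)]
  have c2 : S.comp (x, c) = R.comp (x, y) := by
    rw [cw, (hold w hw hwS).2, S.comp_eq_of_aligned hwS k2.1 (Or.inl hw1)]
  refine ⟨hv.1, fun p hp hpa => ?_, fun p hp hpc => ?_, fun p hp q1 q2 => ?_, fun p => ?_,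
    fun p hp hne => ((hold p hp (hS p hp hne)).1).symm,
    fun p hp hne => ((hold p hp (hS p hp hne)).2).symm, s1, s2, ?_, c1, c2, ?_⟩
  · have hne : p ≠ (x, y) := by rintro rfl; exact hxa hpa
    rcases S.eq_or_eq_of_fst_eq k1.1 k3.1 (hS p hp hne) (by simpa using hyc) rfl hpa with h | h
    · exact k1.2 (h ▸ hp)
    · exact k3.2 (h ▸ hp)
  · have hne : p ≠ (x, y) := by rintro rfl; exact hyc hpc
    rcases S.eq_or_eq_of_snd_eq k2.1 k3.1 (hS p hp hne) (by simpa using hxa) rfl hpc with h | h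
    · exact k2.2 (h ▸ hp)
    · exact k3.2 (h ▸ hp)
  · by_contra hne
    exact (key p (hbox p hp q1 q2) hne).2 hp
  · constructor
    · intro hp
      by_cases hpR : p ∈ R.verts
      · exact Or.inl ⟨hpR, fun e => hv.2 (e ▸ hp)⟩
      · have := (hsd p).1 (Or.inr ⟨hp, hpR⟩)
        have hne : p ≠ (x, y) := fun e => hv.2 (e ▸ hp)
        obtain ⟨p, q⟩ := p
        grind
    · rintro (h | rfl | rfl | rfl)
      exacts [hS p h.1 h.2, k1.1, k2.1, k3.1]
  · rw [S.sgn_eq_not k1.1 k3.1 (Or.inl rfl) (by simpa using hyc), s1]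
  · rw [← S.comp_eq_of_aligned k1.1 k3.1 (Or.inl rfl), c1]

lemma exists_dir {t1 t2 z : Real.Angle} (ht : t1 ≠ t2) (hz : z = t1 ∨ z = t2) :
    ∃ (d : Bool) (a : Real.Angle), z ≠ a ∧ t1 = (if d then z else a) ∧ t2 = if d then a else z := by
  rcases hz with rfl | rfl
  · exact ⟨true, t2, ht, rfl, rfl⟩
  · exact ⟨false, t1, ht.symm, rfl, rfl⟩

lemma IsStabOfOType.exists_stabAt {R S : RectDiagram} {t : OType} (h : IsStabOfOType R S t) :
    ∃ v a c dx dy, StabAt R v a c dx dy S ∧ OType.ofDirs dx dy (R.sgn v) = t := by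
  obtain ⟨t1, t2, p1, p2, hst, p0, hp0, m1, m2, ht⟩ := h
  obtain ⟨⟨x, y⟩, hv⟩ := Finset.card_eq_one.1 (card_sdiff_of_isStabWith hst)
  obtain ⟨⟨ht12, hp12, hsd, -, -, -, hbox, hold⟩, -⟩ := hst
  have hR : ∀ p, p ∈ R.verts ∧ p ∉ S.verts ↔ p = (x, y) := fun p => by
    rw [← Finset.mem_sdiff, hv, Finset.mem_singleton]
  have hxy := (hR (x, y)).2 rfl
  have hcor : (x, y) ∈ corners t1 t2 p1 p2 := by
    rw [← hsd, Finset.mem_symmDiff]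
    exact Or.inl hxy
  obtain ⟨hx, hy⟩ := mem_corners.1 hcor
  obtain ⟨dx, a, hxa, rfl, rfl⟩ := exists_dir ht12 hx
  obtain ⟨dy, c, hyc, rfl, rfl⟩ := exists_dir hp12 hy
  simp only at hxa hyc
  have hsd' : ∀ p, ((p ∈ R.verts ∧ p ∉ S.verts) ∨ (p ∈ S.verts ∧ p ∉ R.verts)) ↔
      (p.1 = x ∨ p.1 = a) ∧ (p.2 = y ∨ p.2 = c) := fun p => by
    rw [← Finset.mem_symmDiff, hsd, mem_corners]
    cases dx <;> cases dy <;> grind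
  have H : StabAt R (x, y) a c dx dy S := by
    refine stabAt_of_mem hxa hyc hsd' hR (fun p hp q1 q2 => ?_) fun p hp hp' =>
      hold p (Finset.mem_inter.2 ⟨hp, hp'⟩)
    have : p ∈ (corners (if dx then x else a) (if dx then a else x) (if dy then y else c)
        (if dy then c else y) : Set Torus) := by
      rw [← hbox]
      refine ⟨?_, Or.inl hp⟩
      cases dx <;> cases dy <;> exact ⟨q1, q2⟩
    rw [Finset.mem_coe, ← hsd, Finset.mem_symmDiff, hsd'] at this
    exact this
  refine ⟨_, a, c, dx, dy, H, ?_⟩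
  have hp0c : p0 = c := by
    have : p0 ≠ y := by
      rintro rfl
      cases dx
      · exact hxy.2 m2
      · exact hxy.2 m1
    cases dy <;> grind
  subst hp0c
  have s1 := H.sgn_snd
  have s2 := H.sgn_opp
  simp only at s1 s2
  cases hs : R.sgn (x, y) <;> rw [hs] at s1 s2 <;> cases t <;>
    have hxy' := ht.1 _ hxy.1 hcor <;> cases dx <;> cases dy <;>
    simp_all [OType.ofDirs, hxa.symm, hyc.symm]


lemma IsElemMoveWith.symm {R S : RectDiagram} {t1 t2 p1 p2 : Real.Angle}
    (h : IsElemMoveWith R S t1 t2 p1 p2) : IsElemMoveWith S R t1 t2 p1 p2 := by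
  obtain ⟨h1, h2, h3, ⟨u, v, hu, hv, huv⟩, h5, h6, h7, h8⟩ := h
  refine ⟨h1, h2, by rwa [symmDiff_comm], ⟨u, v, by rwa [symmDiff_comm], by rwa [symmDiff_comm],
    huv.symm⟩, h6, h5, by rwa [Set.union_comm], fun p hp => ?_⟩
  rw [Finset.inter_comm] at hp
  exact ⟨(h8 p hp).1.symm, (h8 p hp).2.symm⟩

lemma IsExchange.symm {R S : RectDiagram} (h : IsExchange R S) : IsExchange S R := by
  obtain ⟨⟨t1, t2, p1, p2, h⟩, hc⟩ := h
  exact ⟨⟨t1, t2, p1, p2, h.symm⟩, hc.symm⟩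

/-- `S` is obtained from `R` by moving the vertical edge `{x} × {y, z}` to a free meridian. -/
structure MoveAt (R : RectDiagram) (x x' y z : Real.Angle) (S : RectDiagram) : Prop where
  fresh : ∀ p ∈ R.verts, p.1 ≠ x'
  left_mem : (x, y) ∈ R.verts
  right_mem : (x, z) ∈ R.verts
  ne : y ≠ z
  mem_iff : ∀ p, p ∈ S.verts ↔ (p ∈ R.verts ∧ p.1 ≠ x) ∨ p = (x', y) ∨ p = (x', z)
  sgn_old : ∀ p ∈ R.verts, p.1 ≠ x → S.sgn p = R.sgn p
  comp_old : ∀ p ∈ R.verts, p.1 ≠ x → S.comp p = R.comp p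

lemma MoveAt.isExchange {R S : RectDiagram} {x x' y z : Real.Angle} (h : MoveAt R x x' y z S)
    (dx dy : Bool)
    (hbox : ∀ p ∈ R.verts, p.1 ∈ DArc dx x x' → p.2 ∈ DArc dy y z → p.1 = x) :
    IsExchange R S := by
  obtain ⟨h1, h2, h3, h4, h5, h6, h7⟩ := h
  have hxx' : x ≠ x' := h1 _ h2
  have n2 : (x, y) ∉ S.verts := by simp [h5, hxx']
  have n3 : (x, z) ∉ S.verts := by simp [h5, hxx']
  have m2 : (x', y) ∈ S.verts := by simp [h5]
  have m3 : (x', z) ∈ S.verts := by simp [h5]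
  have k2 : (x', y) ∉ R.verts := fun h => h1 _ h rfl
  have k3 : (x', z) ∉ R.verts := fun h => h1 _ h rfl
  have hRx : ∀ p ∈ R.verts, p.1 = x → p = (x, y) ∨ p = (x, z) := fun p hp hpx =>
    R.eq_or_eq_of_fst_eq h2 h3 hp (by simpa using h4) rfl hpx
  refine ⟨⟨_, _, _, _, isElemMoveWith_of_dirs dx dy hxx' h4 ?_ ?_ ⟨_, h2, n2⟩ ⟨_, m2, k2⟩ ?_
    ?_ ?_⟩, ?_⟩
  · intro p
    have := hRx p
    have := h1 p
    have := h5 p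
    obtain ⟨p, q⟩ := p
    constructor
    · simp_all; grind
    · rintro ⟨rfl | rfl, rfl | rfl⟩ <;> simp_all
  · exact ⟨_, _, Finset.mem_symmDiff.2 (Or.inl ⟨h2, n2⟩), Finset.mem_symmDiff.2 (Or.inl ⟨h3, n3⟩),
      Or.inl ⟨h2, h3, by simpa using h4, Or.inl rfl⟩⟩
  · intro p hp q1 q2
    rcases hp with hp | hp
    · rcases hRx p hp (hbox p hp q1 q2) with rfl | rfl <;> simp
    · rcases (h5 p).1 hp with hp | rfl | rfl
      · exact absurd (hbox p hp.1 q1 q2) hp.2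
      · simp
      · simp
  · intro p hp hp'
    refine (h6 p hp fun e => ?_).symm
    rcases hRx p hp e with rfl | rfl <;> contradiction
  · intro p hp hp'
    refine (h7 p hp fun e => ?_).symm
    rcases hRx p hp e with rfl | rfl <;> contradiction
  · have : S.verts = insert (x', y) (insert (x', z) ((R.verts.erase (x, y)).erase (x, z))) := by
      ext p
      rw [h5]
      simp only [Finset.mem_insert, Finset.mem_erase]
      have := hRx p
      grind
    rw [this, Finset.card_insert_of_notMem (by simp [k2, h4]),
      Finset.card_insert_of_notMem (by simp [k3]), Finset.card_erase_of_mem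
      (by simp [h3, h4.symm]), Finset.card_erase_of_mem h2]
    have : 1 < R.verts.card := Finset.one_lt_card.2 ⟨_, h2, _, h3, by simpa using h4⟩
    omega

lemma exists_moveAt (R : RectDiagram) {x x' y z : Real.Angle} (hx' : ∀ p ∈ R.verts, p.1 ≠ x')
    (h1 : (x, y) ∈ R.verts) (h2 : (x, z) ∈ R.verts) (hyz : y ≠ z) :
    ∃ S, MoveAt R x x' y z S ∧ S.sgn (x', y) = R.sgn (x, y) ∧ S.sgn (x', z) = R.sgn (x, z) ∧
      S.comp (x', y) = R.comp (x, y) ∧ S.comp (x', z) = R.comp (x, z) := by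
  have hxx' : x ≠ x' := hx' _ h1
  have hRx : ∀ p ∈ R.verts, p.1 = x → p = (x, y) ∨ p = (x, z) := fun p hp hpx =>
    R.eq_or_eq_of_fst_eq h1 h2 hp (by simpa using hyz) rfl hpx
  refine ⟨R.map (Equiv.prodCongr (Equiv.swap x x') (Equiv.refl _)) (Or.inl fun p q =>
    ⟨(Equiv.swap x x').injective.eq_iff, Iff.rfl⟩), ⟨hx', h1, h2, hyz, ?_, ?_, ?_⟩, ?_, ?_, ?_, ?_⟩
  · rintro ⟨p, q⟩
    simp only [RectDiagram.map, RectDiagram.ofConn, Finset.mem_map_equiv, Equiv.prodCongr_symm,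
      Equiv.symm_swap, Equiv.refl_symm, Equiv.prodCongr_apply, Equiv.coe_refl, Prod.map_apply, id]
    have f1 := hRx (p, q)
    have f2 := hx' (p, q)
    have f3 := hRx (x, q)
    by_cases e1 : p = x
    · subst e1
      rw [Equiv.swap_apply_left]
      simpa [hxx'] using fun h => hx' (x', q) h rfl
    by_cases e2 : p = x'
    · subst e2
      rw [Equiv.swap_apply_right]
      simp_all
      grind
    · rw [Equiv.swap_apply_of_ne_of_ne e1 e2]
      simp [e1, e2]
  · rintro ⟨p, q⟩ hp hne
    simp [RectDiagram.map, RectDiagram.ofConn, Equiv.swap_apply_of_ne_of_ne hne (hx' _ hp)]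
  · rintro ⟨p, q⟩ hp hne
    simp [RectDiagram.map, RectDiagram.ofConn, Equiv.swap_apply_of_ne_of_ne hne (hx' _ hp)]
  all_goals simp [RectDiagram.map, RectDiagram.ofConn]

lemma IsExchange.transpose {R S : RectDiagram} (h : IsExchange R S) :
    IsExchange R.transpose S.transpose := by
  obtain ⟨⟨t1, t2, p1, p2, h1, h2, h3, ⟨u, v, hu, hv, huv⟩, h5, h6, h7, h8⟩, hc⟩ := h
  have hcard : ∀ T : RectDiagram, T.transpose.verts.card = T.verts.card := fun T => by
    simp [RectDiagram.transpose, RectDiagram.map, RectDiagram.ofConn]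
  have hcor : ∀ p : Torus, p ∈ corners p1 p2 t1 t2 ↔ p.swap ∈ corners t1 t2 p1 p2 := fun p => by
    simp [mem_corners, and_comm]
  have hsd : ∀ p, p ∈ symmDiff R.transpose.verts S.transpose.verts ↔
      p.swap ∈ symmDiff R.verts S.verts := fun p => by
    simp [Finset.mem_symmDiff]
  have hedge : ∀ (T : RectDiagram) (u v : Torus), IsEdge T u v →
      IsEdge T.transpose u.swap v.swap := fun T u v h =>
    ⟨by simpa using h.1, by simpa using h.2.1, fun e => h.2.2.1 (Prod.swap_injective e),
      h.2.2.2.symm⟩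
  refine ⟨⟨p1, p2, t1, t2, h2, h1, ?_, ⟨u.swap, v.swap, by simpa [hsd] using hu,
    by simpa [hsd] using hv, huv.imp (hedge R u v) (hedge S u v)⟩, ?_, ?_, ?_, ?_⟩,
    by rw [hcard, hcard, hc]⟩
  · ext p
    rw [hsd, h3, hcor]
  · exact fun h => h5 fun p hp => by simpa using h (x := p.swap) (by simpa using hp)
  · exact fun h => h6 fun p hp => by simpa using h (x := p.swap) (by simpa using hp)
  · ext p
    have := Set.ext_iff.1 h7 p.swap
    simp only [Set.mem_inter_iff, Set.mem_union, Finset.mem_coe, hcor,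
      RectDiagram.mem_transpose_verts] at this ⊢
    rw [← this]
    simp [RectSet, and_comm]
  · intro p hp
    exact h8 p.swap (by simpa using hp)

/-- Two diagrams related by a sequence of exchange moves. -/
def ExEquiv : RectDiagram → RectDiagram → Prop := Relation.ReflTransGen IsExchange

lemma ExEquiv.trans {R S T : RectDiagram} (h : ExEquiv R S) (h' : ExEquiv S T) : ExEquiv R T :=
  Relation.ReflTransGen.trans h h'

lemma ExEquiv.symm {R S : RectDiagram} (h : ExEquiv R S) : ExEquiv S R := by
  induction h with
  | refl => exact .refl
  | tail _ hab ih => exact .head hab.symm ih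

lemma ExEquiv.transpose {R S : RectDiagram} (h : ExEquiv R S) :
    ExEquiv R.transpose S.transpose := by
  induction h with
  | refl => exact .refl
  | tail _ hab ih => exact .tail ih hab.transpose

lemma StabAt.transpose {R S : RectDiagram} {v : Torus} {a c : Real.Angle} {dx dy : Bool}
    (h : StabAt R v a c dx dy S) : StabAt R.transpose v.swap c a dy dx S.transpose where
  mem := by simpa using h.mem
  fst_ne p hp := h.snd_ne p.swap (by simpa using hp)
  snd_ne p hp := h.fst_ne p.swap (by simpa using hp)
  box p hp q1 q2 := by
    have := h.box p.swap (by simpa using hp) q2 q1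
    rw [← this, Prod.swap_swap]
  mem_iff p := by
    rw [RectDiagram.mem_transpose_verts, h.mem_iff, RectDiagram.mem_transpose_verts]
    obtain ⟨p, q⟩ := p
    obtain ⟨x, y⟩ := v
    simp
    grind
  sgn_old p hp hne := h.sgn_old p.swap (by simpa using hp) fun e => hne (by rw [← e, Prod.swap_swap])
  comp_old p hp hne :=
    h.comp_old p.swap (by simpa using hp) fun e => hne (by rw [← e, Prod.swap_swap])
  sgn_fst := h.sgn_snd
  sgn_snd := h.sgn_fst
  sgn_opp := h.sgn_opp
  comp_fst := h.comp_snd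
  comp_snd := h.comp_fst
  comp_opp := h.comp_opp

lemma notMem_of_small {d : Bool} {x a : Real.Angle} {F : Finset Real.Angle} (hax : a ≠ x)
    (h : ∀ z ∈ F, z ∈ DArc d x a → z = x) : a ∉ F := fun ha => hax (h a ha (right_mem_DArc _ _ _))

lemma mem_DArc_of_small {d : Bool} {x a b : Real.Angle} {F : Finset Real.Angle}
    (h : ∀ z ∈ F, z ∈ DArc d x a → z = x) (hb : b ∈ F) (hbx : b ≠ x) : a ∈ DArc d x b :=
  mem_DArc_of_notMem fun h' => hbx (h b hb h')

lemma StabAt.exEquiv_fst {R A B : RectDiagram} {v : Torus} {a a' c : Real.Angle} {dx dy : Bool}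
    (hA : StabAt R v a c dx dy A) (hB : StabAt R v a' c dx dy B) (ha : a' ∈ DArc dx v.1 a)
    (hne : a' ≠ a) : ExEquiv A B := by
  have hm : MoveAt A a a' v.2 c B := by
    have h1 := hA.fst_ne'
    have h2 := hB.fst_ne'
    have h3 := hA.snd_ne'
    refine ⟨fun p hp => ?_, hA.fst_mem, hA.opp_mem, h3, fun p => ?_, fun p hp hpa => ?_,
      fun p hp hpa => ?_⟩
    · rcases (hA.mem_iff p).1 hp with h | rfl | rfl | rfl
      exacts [hB.fst_ne p h.1, hne.symm, h2, hne.symm]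
    · rw [hB.mem_iff, hA.mem_iff]
      have := hA.fst_ne p
      obtain ⟨x, y⟩ := v
      obtain ⟨p, q⟩ := p
      grind
    · rcases (hA.mem_iff p).1 hp with h | rfl | rfl | rfl
      · rw [hA.sgn_old p h.1 h.2, hB.sgn_old p h.1 h.2]
      · exact absurd rfl hpa
      · rw [hA.sgn_snd, hB.sgn_snd]
      · exact absurd rfl hpa
    · rcases (hA.mem_iff p).1 hp with h | rfl | rfl | rfl
      · rw [hA.comp_old p h.1 h.2, hB.comp_old p h.1 h.2]
      · exact absurd rfl hpa
      · rw [hA.comp_snd, hB.comp_snd]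
      · exact absurd rfl hpa
  refine .single (hm.isExchange (!dx) dy fun p hp q1 q2 => ?_)
  rw [DArc_not] at q1
  rcases (hA.mem_iff p).1 hp with h | rfl | rfl | rfl
  · exact absurd (hA.box p h.1 (DArc_subset_right ha q1) q2) h.2
  · rfl
  · exact absurd q1 (notMem_DArc_right ha hB.fst_ne'.symm)
  · rfl

lemma StabAt.exEquiv_snd {R A B : RectDiagram} {v : Torus} {a c c' : Real.Angle} {dx dy : Bool}
    (hA : StabAt R v a c dx dy A) (hB : StabAt R v a c' dx dy B) (hc : c' ∈ DArc dy v.2 c)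
    (hne : c' ≠ c) : ExEquiv A B := by
  simpa using (hA.transpose.exEquiv_fst hB.transpose hc hne).transpose

lemma StabAt.shrink {R A : RectDiagram} {v : Torus} {a a' c c' : Real.Angle} {dx dy : Bool}
    (hA : StabAt R v a c dx dy A) (ha : a' ∈ DArc dx v.1 a) (hc : c' ∈ DArc dy v.2 c)
    (haR : ∀ p ∈ R.verts, p.1 ≠ a') (hcR : ∀ p ∈ R.verts, p.2 ≠ c') :
    ∃ B, StabAt R v a' c' dx dy B :=
  exists_stabAt R hA.mem haR hcR fun p hp q1 q2 =>
    hA.box p hp (DArc_subset_left ha q1) (DArc_subset_left hc q2)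

/-- Two stabilizations at the same vertex in the same directions differ by exchange moves. -/
lemma StabAt.exEquiv {R A B : RectDiagram} {v : Torus} {a a' c c' : Real.Angle} {dx dy : Bool}
    (hA : StabAt R v a c dx dy A) (hB : StabAt R v a' c' dx dy B) : ExEquiv A B := by
  obtain ⟨a0, ha0, ha⟩ := exists_DArc_inter_subset dx v.1
    (insert a (insert a' (R.verts.image Prod.fst)))
  obtain ⟨c0, hc0, hc⟩ := exists_DArc_inter_subset dy v.2
    (insert c (insert c' (R.verts.image Prod.snd)))
  have ha1 := notMem_of_small ha0 ha
  have hc1 := notMem_of_small hc0 hc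
  have haa := mem_DArc_of_small ha (b := a) (by simp) hA.fst_ne'.symm
  have haa' := mem_DArc_of_small ha (b := a') (by simp) hB.fst_ne'.symm
  have hcc := mem_DArc_of_small hc (b := c) (by simp) hA.snd_ne'.symm
  have hcc' := mem_DArc_of_small hc (b := c') (by simp) hB.snd_ne'.symm
  have haR : ∀ p ∈ R.verts, p.1 ≠ a0 := fun p hp e => ha1 (by
    simp only [Finset.mem_insert, Finset.mem_image]; exact Or.inr (Or.inr ⟨p, hp, e⟩))
  have hcR : ∀ p ∈ R.verts, p.2 ≠ c0 := fun p hp e => hc1 (by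
    simp only [Finset.mem_insert, Finset.mem_image]; exact Or.inr (Or.inr ⟨p, hp, e⟩))
  simp only [Finset.mem_insert, not_or] at ha1 hc1
  obtain ⟨M, hM⟩ := hA.shrink haa (right_mem_DArc _ _ _) haR hA.snd_ne
  obtain ⟨M', hM'⟩ := hB.shrink haa' (right_mem_DArc _ _ _) haR hB.snd_ne
  obtain ⟨N, hN⟩ := hM.shrink (right_mem_DArc _ _ _) hcc haR hcR
  exact (hA.exEquiv_fst hM haa ha1.1).trans ((hM.exEquiv_snd hN hcc hc1.1).trans
    ((hM'.exEquiv_snd hN hcc' hc1.2.1).symm.trans (hB.exEquiv_fst hM' haa' ha1.2.1).symm))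

lemma notMem_DArc_of_notMem_not {d : Bool} {x a b : Real.Angle} (ha : a ≠ x) (hb : b ≠ x)
    (h : a ∉ DArc (!d) x b) : b ∉ DArc d x a := by
  have := lin_injective.ne ha
  have := lin_injective.ne hb
  rw [DArc_not] at h
  simp only [mem_DArc_iff, mem_Arc_iff] at *; grind

/-- Stabilizations at the ends of a vertical edge, in opposite directions, differ by exchange
moves. -/
lemma StabAt.exEquiv_of_fst_eq {R A B : RectDiagram} {v w : Torus} {a a' c c' : Real.Angle}
    {dx dy : Bool} (hA : StabAt R v a c dx dy A) (hB : StabAt R w a' c' (!dx) (!dy) B)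
    (hvw : v.1 = w.1) (hne : v ≠ w) : ExEquiv A B := by
  obtain ⟨x, y⟩ := v
  obtain ⟨x2, y'⟩ := w
  obtain rfl : x = x2 := hvw
  have hv := hA.mem
  have hw := hB.mem
  have hyy' : y ≠ y' := by simpa using hne
  clear hne
  have hs := R.sgn_eq_not hv hw (Or.inl rfl) (by simpa using hyy')
  have hcc := R.comp_eq_of_aligned hv hw (Or.inl rfl)
  obtain ⟨c0, hc0, hc⟩ := exists_DArc_inter_subset dy y (R.verts.image Prod.snd)
  obtain ⟨a0, ha0, ha⟩ := exists_DArc_inter_subset dx x (R.verts.image Prod.fst)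
  obtain ⟨b0, hb0, hb⟩ := exists_DArc_inter_subset (!dx) x (insert a0 (R.verts.image Prod.fst))
  have hcy' : c0 ∈ DArc dy y y' :=
    mem_DArc_of_small hc (Finset.mem_image.2 ⟨_, hw, rfl⟩) hyy'.symm
  have hRx : ∀ p ∈ R.verts, p.1 = x → p = (x, y) ∨ p = (x, y') := fun p hp hpx =>
    R.eq_or_eq_of_fst_eq hv hw hp (by simpa using hyy') rfl hpx
  have hcR : ∀ p ∈ R.verts, p.2 ≠ c0 := fun p hp e =>
    notMem_of_small hc0 hc (Finset.mem_image.2 ⟨p, hp, e⟩)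
  have haR : ∀ p ∈ R.verts, p.1 ≠ a0 := fun p hp e =>
    notMem_of_small ha0 ha (Finset.mem_image.2 ⟨p, hp, e⟩)
  have hbR : ∀ p ∈ R.verts, p.1 ≠ b0 := fun p hp e =>
    notMem_of_small hb0 hb (Finset.mem_insert_of_mem (Finset.mem_image.2 ⟨p, hp, e⟩))
  have hab : a0 ≠ b0 := fun e => notMem_of_small hb0 hb (by simp [e])
  have ha' : ∀ p ∈ R.verts, p.1 ∈ DArc dx x a0 → p.1 = x := fun p hp =>
    ha p.1 (Finset.mem_image_of_mem _ hp)
  have hb' : ∀ p ∈ R.verts, p.1 ∈ DArc (!dx) x b0 → p.1 = x := fun p hp =>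
    hb p.1 (Finset.mem_insert_of_mem (Finset.mem_image_of_mem _ hp))
  have hab1 : a0 ∉ DArc (!dx) x b0 := fun h => ha0 (hb a0 (by simp) h)
  have hab2 : b0 ∉ DArc dx x a0 := notMem_DArc_of_notMem_not ha0 hb0 hab1
  have hyc := hcR _ hv
  have hyc' := hcR _ hw
  simp only at hyc hyc'
  obtain ⟨A1, hA1⟩ := exists_stabAt R (dx := dx) (dy := dy) hv haR hcR fun p hp q1 q2 =>
    Prod.ext (ha' p hp q1) (hc p.2 (Finset.mem_image_of_mem _ hp) q2)
  obtain ⟨B1, hB1⟩ := exists_stabAt R (dx := !dx) (dy := !dy) hw hbR hcR fun p hp q1 q2 => by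
    rcases hRx p hp (hb' p hp q1) with rfl | rfl
    · rw [DArc_not] at q2
      exact absurd q2 (notMem_DArc_right hcy' hc0)
    · rfl
  refine (hA.exEquiv hA1).trans (ExEquiv.trans ?_ (hB.exEquiv hB1).symm)
  have f1 := hA1.mem_iff
  have f2 := hB1.mem_iff
  have m1 : (x, y') ∈ A1.verts := (f1 _).2 (Or.inl ⟨hw, by simpa using hyy'.symm⟩)
  have m2 : (x, y) ∈ B1.verts := (f2 _).2 (Or.inl ⟨hv, by simpa using hyy'⟩)
  have fr1 : ∀ p ∈ A1.verts, p.1 ≠ b0 := fun p hp => by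
    rcases (f1 p).1 hp with h | rfl | rfl | rfl
    exacts [hbR p h.1, hab, hb0.symm, hab]
  have fr2 : ∀ p ∈ B1.verts, p.1 ≠ a0 := fun p hp => by
    rcases (f2 p).1 hp with h | rfl | rfl | rfl
    exacts [haR p h.1, hab.symm, ha0.symm, hab.symm]
  obtain ⟨M, hM, s1, s2, k1, k2⟩ := exists_moveAt A1 fr1 m1 hA1.snd_mem hyc'
  have hM' : MoveAt B1 x a0 y c0 M := by
    refine ⟨fr2, m2, hB1.snd_mem, hyc, fun p => ?_, fun p hp hpx => ?_, fun p hp hpx => ?_⟩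
    · rw [hM.mem_iff, f1, f2]
      have := hRx p
      obtain ⟨p, q⟩ := p
      clear * - this ha0 hb0 hab
      grind
    · rcases (f2 p).1 hp with h | rfl | rfl | rfl
      · have hne : p ≠ (x, y) := by rintro rfl; exact hpx rfl
        rw [hM.sgn_old p ((f1 p).2 (Or.inl ⟨h.1, hne⟩)) hpx, hA1.sgn_old p h.1 hne,
          hB1.sgn_old p h.1 h.2]
      · rw [s1, hB1.sgn_fst, hA1.sgn_old _ hw (by simpa using hyy'.symm)]
      · exact absurd rfl hpx
      · rw [s2, hB1.sgn_opp, hA1.sgn_snd, hs, Bool.not_not]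
    · rcases (f2 p).1 hp with h | rfl | rfl | rfl
      · have hne : p ≠ (x, y) := by rintro rfl; exact hpx rfl
        rw [hM.comp_old p ((f1 p).2 (Or.inl ⟨h.1, hne⟩)) hpx, hA1.comp_old p h.1 hne,
          hB1.comp_old p h.1 h.2]
      · rw [k1, hB1.comp_fst, hA1.comp_old _ hw (by simpa using hyy'.symm)]
      · exact absurd rfl hpx
      · rw [k2, hB1.comp_opp, hA1.comp_snd, hcc]
  refine .head (hM.isExchange (!dx) true fun p hp q1 _ => ?_)
    (.single (hM'.isExchange dx true fun p hp q1 _ => ?_).symm)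
  · rcases (f1 p).1 hp with h | rfl | rfl | rfl
    exacts [hb' p h.1 q1, absurd q1 hab1, rfl, absurd q1 hab1]
  · rcases (f2 p).1 hp with h | rfl | rfl | rfl
    exacts [ha' p h.1 q1, absurd q1 hab2, rfl, absurd q1 hab2]

lemma StabAt.exEquiv_of_aligned {R A B : RectDiagram} {v w : Torus} {a a' c c' : Real.Angle}
    {dx dy : Bool} (hA : StabAt R v a c dx dy A) (hB : StabAt R w a' c' (!dx) (!dy) B)
    (hvw : Aligned v w) (hne : v ≠ w) : ExEquiv A B := by
  rcases hvw with h | h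
  · exact hA.exEquiv_of_fst_eq hB h hne
  · simpa using (hA.transpose.exEquiv_of_fst_eq hB.transpose h
      fun e => hne (Prod.swap_injective e)).transpose

/-- Stabilizations may be performed in an arbitrarily small neighbourhood of a vertex. -/
lemma exists_small_stabAt (R : RectDiagram) {v : Torus} (hv : v ∈ R.verts) (dx dy : Bool) :
    ∃ a c S, StabAt R v a c dx dy S := by
  obtain ⟨c, hc0, hc⟩ := exists_DArc_inter_subset dy v.2 (R.verts.image Prod.snd)
  obtain ⟨a, ha0, ha⟩ := exists_DArc_inter_subset dx v.1 (R.verts.image Prod.fst)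
  obtain ⟨S, hS⟩ := exists_stabAt R (v := v) (dx := dx) (dy := dy) hv
    (fun p hp e => notMem_of_small ha0 ha (Finset.mem_image.2 ⟨p, hp, e⟩))
    (fun p hp e => notMem_of_small hc0 hc (Finset.mem_image.2 ⟨p, hp, e⟩)) fun p hp q1 q2 =>
    Prod.ext (ha _ (Finset.mem_image_of_mem _ hp) q1) (hc _ (Finset.mem_image_of_mem _ hp) q2)
  exact ⟨a, c, S, hS⟩

/-- Stabilizations of the same oriented type on the same component differ by exchange moves. -/
lemma StabAt.exEquiv_of_conn {R A B : RectDiagram} {v w : Torus} {a a' c c' : Real.Angle}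
    {dx dy dx' dy' : Bool} (hA : StabAt R v a c dx dy A) (hB : StabAt R w a' c' dx' dy' B)
    (h : Conn R.verts v w)
    (ht : OType.ofDirs dx dy (R.sgn v) = OType.ofDirs dx' dy' (R.sgn w)) : ExEquiv A B := by
  induction h generalizing a' c' dx' dy' B with
  | refl =>
    obtain ⟨rfl, rfl⟩ := OType.ofDirs_injective ht
    exact hA.exEquiv hB
  | @tail u w _ huw ih =>
    obtain ⟨hu, hw, huw⟩ := huw
    by_cases hne : u = w
    · subst hne
      exact ih hB ht
    · obtain ⟨a0, c0, S, hS⟩ := exists_small_stabAt R hu (!dx') (!dy')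
      have hs := R.sgn_eq_not hu hw huw hne
      refine (ih hS ?_).trans (hS.exEquiv_of_aligned (by simpa using hB) huw hne)
      rw [ht, hs, ← OType.ofDirs_not, Bool.not_not]

lemma IsElemMoveWith.mem_corners_iff {R S : RectDiagram} {t1 t2 p1 p2 : Real.Angle}
    (h : IsElemMoveWith R S t1 t2 p1 p2) (p : Torus) :
    p ∈ corners t1 t2 p1 p2 ↔ (p ∈ R.verts ∧ p ∉ S.verts) ∨ (p ∈ S.verts ∧ p ∉ R.verts) := by
  rw [← h.2.2.1, Finset.mem_symmDiff]

lemma StabAt.mem_iff_of_ne {R S : RectDiagram} {v : Torus} {a c : Real.Angle} {dx dy : Bool}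
    (h : StabAt R v a c dx dy S) {p : Torus} (hv : p ≠ v) (ha : p.1 ≠ a) (hc : p.2 ≠ c) :
    p ∈ S.verts ↔ p ∈ R.verts := by
  rw [h.mem_iff]
  constructor
  · rintro (h | rfl | rfl | rfl)
    exacts [h.1, absurd rfl ha, absurd rfl hc, absurd rfl ha]
  · exact fun h => Or.inl ⟨h, hv⟩

/-- A stabilization in a small neighbourhood of a vertex commutes with an elementary move that
keeps this vertex. -/
lemma IsElemMoveWith.exists_stabAt {R R' : RectDiagram} {t1 t2 p1 p2 : Real.Angle}
    (h : IsElemMoveWith R R' t1 t2 p1 p2) {v : Torus} (hv : v ∈ R.verts) (hv' : v ∈ R'.verts)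
    (dx dy : Bool) : ∃ a c S S', StabAt R v a c dx dy S ∧ StabAt R' v a c dx dy S' ∧
      IsElemMoveWith S S' t1 t2 p1 p2 ∧ t1 ≠ a ∧ t2 ≠ a ∧ p1 ≠ c ∧ p2 ≠ c := by
  obtain ⟨a, ha0, ha⟩ := exists_DArc_inter_subset dx v.1
    ({t1, t2} ∪ (R.verts ∪ R'.verts).image Prod.fst)
  obtain ⟨c, hc0, hc⟩ := exists_DArc_inter_subset dy v.2
    ({p1, p2} ∪ (R.verts ∪ R'.verts).image Prod.snd)
  have haV : ∀ p, p ∈ R.verts ∨ p ∈ R'.verts →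
      p.1 ∈ ({t1, t2} ∪ (R.verts ∪ R'.verts).image Prod.fst : Finset Real.Angle) := fun p hp =>
    Finset.mem_union_right _ (Finset.mem_image_of_mem _ (Finset.mem_union.2 hp))
  have hcV : ∀ p, p ∈ R.verts ∨ p ∈ R'.verts →
      p.2 ∈ ({p1, p2} ∪ (R.verts ∪ R'.verts).image Prod.snd : Finset Real.Angle) := fun p hp =>
    Finset.mem_union_right _ (Finset.mem_image_of_mem _ (Finset.mem_union.2 hp))
  have haF := notMem_of_small ha0 ha
  have hcF := notMem_of_small hc0 hc
  have fa : ∀ p, p ∈ R.verts ∨ p ∈ R'.verts → p.1 ≠ a := fun p hp e => haF (e ▸ haV p hp)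
  have fc : ∀ p, p ∈ R.verts ∨ p ∈ R'.verts → p.2 ≠ c := fun p hp e => hcF (e ▸ hcV p hp)
  have ht1 : t1 ≠ a := fun e => haF (by simp [e])
  have ht2 : t2 ≠ a := fun e => haF (by simp [e])
  have hp1 : p1 ≠ c := fun e => hcF (by simp [e])
  have hp2 : p2 ≠ c := fun e => hcF (by simp [e])
  have hbox : ∀ p, p ∈ R.verts ∨ p ∈ R'.verts → p.1 ∈ DArc dx v.1 a → p.2 ∈ DArc dy v.2 c →
      p = v := fun p hp q1 q2 => Prod.ext (ha _ (haV p hp) q1) (hc _ (hcV p hp) q2)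
  obtain ⟨S, hS⟩ := RectDiag.exists_stabAt R hv (fun p hp => fa p (Or.inl hp))
    (fun p hp => fc p (Or.inl hp)) fun p hp => hbox p (Or.inl hp)
  obtain ⟨S', hS'⟩ := RectDiag.exists_stabAt R' hv' (fun p hp => fa p (Or.inr hp))
    (fun p hp => fc p (Or.inr hp)) fun p hp => hbox p (Or.inr hp)
  refine ⟨a, c, S, S', hS, hS', ?_, ht1, ht2, hp1, hp2⟩
  have hcor := h.mem_corners_iff
  have hvc : v ∉ corners t1 t2 p1 p2 := by simp [hcor, hv, hv']
  have hSR : ∀ p ∈ corners t1 t2 p1 p2, p ∈ S.verts ↔ p ∈ R.verts := fun p hp =>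
    hS.mem_iff_of_ne (fun e => hvc (e ▸ hp)) (fa p (((hcor p).1 hp).imp And.left And.left))
      (fc p (((hcor p).1 hp).imp And.left And.left))
  have hSR' : ∀ p ∈ corners t1 t2 p1 p2, p ∈ S'.verts ↔ p ∈ R'.verts := fun p hp =>
    hS'.mem_iff_of_ne (fun e => hvc (e ▸ hp)) (fa p (((hcor p).1 hp).imp And.left And.left))
      (fc p (((hcor p).1 hp).imp And.left And.left))
  have hsd : symmDiff S.verts S'.verts = corners t1 t2 p1 p2 := by
    ext p
    rw [Finset.mem_symmDiff]
    constructor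
    · rw [hcor, hS.mem_iff, hS'.mem_iff]
      tauto
    · intro hp
      rw [hSR p hp, hSR' p hp, ← hcor]
      exact hp
  obtain ⟨h1, h2, h3, ⟨u, w, hu, hw, huw⟩, h5, h6, h7, h8⟩ := h
  have hout : v ∉ RectSet t1 t2 p1 p2 := fun hr => hvc (by
    rw [← Finset.mem_coe, ← h7]
    exact ⟨hr, Or.inl hv⟩)
  rw [h3] at hu hw
  refine ⟨h1, h2, hsd, ⟨u, w, hsd ▸ hu, hsd ▸ hw, ?_⟩, ?_, ?_, ?_, fun p hp => ?_⟩
  · unfold IsEdge at huw ⊢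
    rwa [hSR u hu, hSR w hw, hSR' u hu, hSR' w hw]
  · intro hss
    obtain ⟨p, hp, hp'⟩ := Finset.not_subset.1 h5
    have hpc := (hcor p).2 (Or.inl ⟨hp, hp'⟩)
    exact hp' ((hSR' p hpc).1 (hss ((hSR p hpc).2 hp)))
  · intro hss
    obtain ⟨p, hp, hp'⟩ := Finset.not_subset.1 h6
    have hpc := (hcor p).2 (Or.inr ⟨hp, hp'⟩)
    exact hp' ((hSR p hpc).1 (hss ((hSR' p hpc).2 hp)))
  · have key : ∀ p, p ∈ S.verts ∨ p ∈ S'.verts → p ∈ RectSet t1 t2 p1 p2 →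
        p ∈ R.verts ∨ p ∈ R'.verts := by
      have hx : v.1 ∉ Arc t1 t2 → a ∉ Arc t1 t2 := fun hx =>
        notMem_Arc_of_mem_DArc hx
          (fun e => hx (ha t1 (by simp) e ▸ left_mem_DArc true t1 t2))
          (fun e => hx (ha t2 (by simp) e ▸ right_mem_DArc true t1 t2)) (right_mem_DArc dx _ _)
      have hy : v.2 ∉ Arc p1 p2 → c ∉ Arc p1 p2 := fun hy =>
        notMem_Arc_of_mem_DArc hy
          (fun e => hy (hc p1 (by simp) e ▸ left_mem_DArc true p1 p2))
          (fun e => hy (hc p2 (by simp) e ▸ right_mem_DArc true p1 p2)) (right_mem_DArc dy _ _)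
      have hout' : v.1 ∈ Arc t1 t2 → v.2 ∉ Arc p1 p2 := fun q1 q2 => hout ⟨q1, q2⟩
      intro p hp hr
      rw [hS.mem_iff, hS'.mem_iff] at hp
      rcases hp with (hp | rfl | rfl | rfl) | hp | rfl | rfl | rfl
      · exact Or.inl hp.1
      · exact absurd hr.1 (hx fun q => hout' q hr.2)
      · exact absurd hr.2 (hy (hout' hr.1))
      · exact absurd hr.2 (hy (hout' (by_contra fun q => hx q hr.1)))
      · exact Or.inr hp.1
      · exact absurd hr.1 (hx fun q => hout' q hr.2)
      · exact absurd hr.2 (hy (hout' hr.1))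
      · exact absurd hr.2 (hy (hout' (by_contra fun q => hx q hr.1)))
    ext p
    rw [← hsd]
    constructor
    · rintro ⟨q1, q2⟩
      have : p ∈ (corners t1 t2 p1 p2 : Set Torus) := by
        rw [← h7]
        exact ⟨q1, by simpa using key p (by simpa using q2) q1⟩
      rwa [hsd]
    · intro hp
      have hp' : p ∈ (corners t1 t2 p1 p2 : Set Torus) := hsd ▸ hp
      rw [← h7] at hp'
      refine ⟨hp'.1, ?_⟩
      exact (Finset.mem_symmDiff.1 (Finset.mem_coe.1 hp)).imp And.left And.left
  · rw [Finset.mem_inter, hS.mem_iff] at hp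
    have hvl := h8 v (Finset.mem_inter.2 ⟨hv, hv'⟩)
    obtain ⟨hp | rfl | rfl | rfl, hp'⟩ := hp
    · have hpR' : p ∈ R'.verts :=
        (hS'.mem_iff_of_ne hp.2 (fa p (Or.inl hp.1)) (fc p (Or.inl hp.1))).1 hp'
      rw [hS.sgn_old p hp.1 hp.2, hS.comp_old p hp.1 hp.2, hS'.sgn_old p hpR' hp.2,
        hS'.comp_old p hpR' hp.2]
      exact h8 p (Finset.mem_inter.2 ⟨hp.1, hpR'⟩)
    · rw [hS.sgn_fst, hS'.sgn_fst, hS.comp_fst, hS'.comp_fst]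
      exact hvl
    · rw [hS.sgn_snd, hS'.sgn_snd, hS.comp_snd, hS'.comp_snd]
      exact hvl
    · rw [hS.sgn_opp, hS'.sgn_opp, hS.comp_opp, hS'.comp_opp, hvl.1]
      exact ⟨rfl, hvl.2⟩

lemma ModifiesComp.stabAt {R R' S S' : RectDiagram} {v : Torus} {a c : Real.Angle} {dx dy : Bool}
    (hS : StabAt R v a c dx dy S) (hS' : StabAt R' v a c dx dy S') {i : ℕ}
    (h : ModifiesComp R R' i) : ModifiesComp S S' i := by
  obtain ⟨w, hw, hw', hi⟩ := h
  have hne : w ≠ v := fun e => hw' (e ▸ hS'.mem)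
  refine ⟨w, (hS.mem_iff w).2 (Or.inl ⟨hw, hne⟩), fun h => hw' ?_, ?_⟩
  · exact (hS'.mem_iff_of_ne hne (hS.fst_ne w hw) (hS.snd_ne w hw)).1 h
  · rw [hS.comp_old w hw hne, hi]

lemma KindOk.exists_stabAt {R R' : RectDiagram} {k : MoveKind} (h : KindOk R R' k)
    (hk : ∀ t i, k ≠ .stab t i) {v : Torus} (hv : v ∈ R.verts) (hv' : v ∈ R'.verts)
    (dx dy : Bool) : ∃ a c S S', StabAt R v a c dx dy S ∧ StabAt R' v a c dx dy S' ∧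
      KindOk S S' k := by
  cases k with
  | stab t i => exact absurd rfl (hk t i)
  | exchange =>
    obtain ⟨⟨t1, t2, p1, p2, h⟩, hc⟩ := h
    obtain ⟨a, c, S, S', hS, hS', hSS', -⟩ := h.exists_stabAt hv hv' dx dy
    exact ⟨a, c, S, S', hS, hS', ⟨t1, t2, p1, p2, hSS'⟩, by rw [hS.card_eq, hS'.card_eq, hc]⟩
  | destab t i =>
    obtain ⟨⟨t1, t2, p1, p2, ⟨h, hc⟩, p0, hp0, m1, m2, ht⟩, hi⟩ := h
    obtain ⟨a, c, S', S, hS', hS, hSS', n1, n2, n3, n4⟩ := h.exists_stabAt hv' hv dx dy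
    have hvc : v ∉ corners t1 t2 p1 p2 := by simp [h.mem_corners_iff, hv, hv']
    have hc0 : p0 ≠ c := by rcases hp0 with rfl | rfl <;> assumption
    have hne1 : (t1, p0) ≠ v := by
      rintro rfl
      exact hvc (mem_corners.2 ⟨Or.inl rfl, hp0⟩)
    have hne2 : (t2, p0) ≠ v := by
      rintro rfl
      exact hvc (mem_corners.2 ⟨Or.inr rfl, hp0⟩)
    refine ⟨a, c, S, S', hS, hS', ⟨t1, t2, p1, p2, ⟨hSS', by rw [hS.card_eq, hS'.card_eq, hc]⟩, p0,
      hp0, (hS.mem_iff_of_ne hne1 n1 hc0).2 m1, (hS.mem_iff_of_ne hne2 n2 hc0).2 m2, ?_⟩,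
      hi.stabAt hS hS'⟩
    have hcor : ∀ p ∈ S'.verts, p ∈ corners t1 t2 p1 p2 → p ∈ R'.verts := fun p hp hpc => by
      refine (hS'.mem_iff_of_ne (fun e => hvc (e ▸ hpc)) ?_ ?_).1 hp
      · rcases (mem_corners.1 hpc).1 with e | e <;> rwa [e]
      · rcases (mem_corners.1 hpc).2 with e | e <;> rwa [e]
    rw [hS.sgn_old _ m2 hne2]
    cases t <;> exact ⟨fun p hp hpc => ht.1 p (hcor p hp hpc) hpc, ht.2⟩

lemma KindOk.exists_elemMove {R S : RectDiagram} {k : MoveKind} (h : KindOk R S k)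
    (hk : ∀ t i, k ≠ .stab t i) :
    (∃ t1 t2 p1 p2, IsElemMoveWith R S t1 t2 p1 p2) ∧ S.verts.card ≤ R.verts.card := by
  cases k with
  | stab t i => exact absurd rfl (hk t i)
  | exchange => exact ⟨h.1, h.2.le⟩
  | destab t i =>
    obtain ⟨⟨t1, t2, p1, p2, ⟨h, hc⟩, -⟩, -⟩ := h
    exact ⟨⟨t1, t2, p1, p2, h.symm⟩, by omega⟩

lemma IsElemMoveWith.exists_mem_comp_eq {R S : RectDiagram} {t1 t2 p1 p2 : Real.Angle}
    (h : IsElemMoveWith R S t1 t2 p1 p2) (hc : S.verts.card ≤ R.verts.card) {u : Torus}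
    (hu : u ∈ S.verts) : ∃ v ∈ R.verts, v ∈ S.verts ∧ S.comp v = S.comp u := by
  by_contra! hno
  obtain ⟨w, hw, hwu, hwne⟩ := S.exists_fst_eq hu
  obtain ⟨z, hz, hzu, hzne⟩ := S.exists_snd_eq hu
  have hu' : u ∉ R.verts := fun h' => hno u h' hu rfl
  have hw' : w ∉ R.verts := fun h' => hno w h' hw (S.comp_eq_of_aligned hw hu (Or.inl hwu))
  have hz' : z ∉ R.verts := fun h' => hno z h' hz (S.comp_eq_of_aligned hz hu (Or.inr hzu))
  have hwz : w ≠ z := fun e => hwne (Prod.ext hwu (e ▸ hzu))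
  have h3 : 2 < (S.verts \ R.verts).card := Finset.two_lt_card.2 ⟨u, by simp [hu, hu'], w,
    by simp [hw, hw'], z, by simp [hz, hz'], hwne.symm, hzne.symm, hwz⟩
  have h1 : (symmDiff R.verts S.verts).card = 4 := by
    rw [h.2.2.1, card_corners h.1 h.2.1]
  rw [symmDiff_def, Finset.sup_eq_union, Finset.card_union_of_disjoint disjoint_sdiff_sdiff] at h1
  have h2 := Finset.card_sdiff_add_card_inter R.verts S.verts
  have h4 := Finset.card_sdiff_add_card_inter S.verts R.verts
  rw [Finset.inter_comm] at h4
  omega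

/-- A stabilization following an exchange move or a destabilization may be performed before it, at
the cost of some additional exchange moves. -/
lemma KindOk.commute_stab {R S T : RectDiagram} {k : MoveKind} {t : OType} {i : ℕ}
    (h : KindOk R S k) (hk : ∀ t i, k ≠ .stab t i) (hst : KindOk S T (.stab t i)) :
    ∃ R' S', KindOk R R' (.stab t i) ∧ KindOk R' S' k ∧ ExEquiv S' T := by
  obtain ⟨hst, hi⟩ := hst
  obtain ⟨u, a, c, dx, dy, hT, rfl⟩ := hst.exists_stabAt
  obtain ⟨⟨t1, t2, p1, p2, hm⟩, hc⟩ := h.exists_elemMove hk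
  obtain ⟨v, hvR, hvS, hvu⟩ := hm.exists_mem_comp_eq hc hT.mem
  obtain ⟨dx', dy', ht⟩ := OType.exists_ofDirs (OType.ofDirs dx dy (S.sgn u)) (S.sgn v)
  obtain ⟨a', c', R', S', hR', hS', hk'⟩ := h.exists_stabAt hk hvR hvS dx' dy'
  have hv := hm.2.2.2.2.2.2.2 v (Finset.mem_inter.2 ⟨hvR, hvS⟩)
  refine ⟨R', S', ⟨?_, ?_⟩, hk', ?_⟩
  · rw [← ht, ← hv.1]
    exact hR'.isStabOfOType
  · rw [hR'.modifiesComp_iff, hv.2, hvu]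
    exact hT.modifiesComp_iff.1 hi
  · exact hS'.exEquiv_of_conn hT ((S.comp_eq_iff_conn hvS hT.mem).1 hvu) ht

/-- The kind of the reversed move. -/
def MoveKind.reverse : MoveKind → MoveKind
  | .exchange => .exchange
  | .stab t i => .destab t i
  | .destab t i => .stab t i

lemma MoveKind.reverse_involutive : Function.Involutive MoveKind.reverse := by
  rintro (_ | _ | _) <;> rfl

lemma IsStabOfOType.modifiesComp_iff {R S : RectDiagram} {t : OType} (h : IsStabOfOType R S t)
    {i : ℕ} : ModifiesComp R S i ↔ ModifiesComp S R i := by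
  obtain ⟨v, a, c, dx, dy, hS, -⟩ := h.exists_stabAt
  rw [hS.modifiesComp_iff, hS.modifiesComp_symm_iff]

lemma KindOk.reverse {R S : RectDiagram} {k : MoveKind} (h : KindOk R S k) :
    KindOk S R k.reverse := by
  cases k with
  | exchange => exact IsExchange.symm h
  | stab t i => exact ⟨h.1, h.1.modifiesComp_iff.1 h.2⟩
  | destab t i => exact ⟨h.1, (IsStabOfOType.modifiesComp_iff h.1).2 h.2⟩

lemma lChain_append {s s' : List (MoveKind × RectDiagram)} {R R' : RectDiagram} :
    LChain R (s ++ s') R' ↔ ∃ M, LChain R s M ∧ LChain M s' R' := by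
  induction s generalizing R with
  | nil => simp [LChain]
  | cons p s ih => simp [LChain, ih, and_assoc]

lemma LChain.reverse {s : List (MoveKind × RectDiagram)} {R R' : RectDiagram}
    (h : LChain R s R') :
    ∃ s', LChain R' s' R ∧ s'.map Prod.fst = ((s.map Prod.fst).map MoveKind.reverse).reverse := by
  induction s generalizing R with
  | nil => exact ⟨[], Eq.symm h, rfl⟩
  | cons p s ih =>
    obtain ⟨s', hs', hm⟩ := ih h.2
    exact ⟨s' ++ [(p.1.reverse, R)], lChain_append.2 ⟨p.2, hs', KindOk.reverse h.1, rfl⟩, by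
      simp [hm]⟩

lemma count_map_reverse (l : List MoveKind) (k : MoveKind) :
    ((l.map MoveKind.reverse).reverse).count k = l.count k.reverse := by
  rw [List.count_reverse, ← List.count_map_of_injective l _ MoveKind.reverse_involutive.injective,
    MoveKind.reverse_involutive]

lemma ExEquiv.exists_lChain {R S : RectDiagram} (h : ExEquiv R S) :
    ∃ b, LChain R b S ∧ ∀ p ∈ b, p.1 = MoveKind.exchange := by
  induction h with
  | refl => exact ⟨[], rfl, by simp⟩
  | @tail M S _ hMS ih =>
    obtain ⟨b, hb, hb'⟩ := ih
    refine ⟨b ++ [(.exchange, S)], lChain_append.2 ⟨M, hb, ?_⟩, fun p hp => ?_⟩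
    · exact ⟨hMS, rfl⟩
    rcases List.mem_append.1 hp with hp | hp
    · exact hb' p hp
    · rw [List.mem_singleton.1 hp]

lemma count_map_fst_eq_zero {s : List (MoveKind × RectDiagram)} {k : MoveKind}
    (h : ∀ p ∈ s, p.1 ≠ k) : (s.map Prod.fst).count k = 0 := by
  rw [List.count_eq_zero, List.mem_map]
  rintro ⟨p, hp, e⟩
  exact h p hp e

lemma forall_ne_of_count_eq_zero {s : List (MoveKind × RectDiagram)} {k : MoveKind}
    (h : (s.map Prod.fst).count k = 0) : ∀ p ∈ s, p.1 ≠ k := by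
  rw [List.count_eq_zero, List.mem_map] at h
  exact fun p hp e => h ⟨p, hp, e⟩

lemma LChain.commute_stab {s : List (MoveKind × RectDiagram)} {R S T : RectDiagram} {t : OType}
    {i : ℕ} (h : LChain R s S) (hs : ∀ p ∈ s, ∀ t i, p.1 ≠ MoveKind.stab t i)
    (hst : KindOk S T (.stab t i)) :
    ∃ R' s', KindOk R R' (.stab t i) ∧ LChain R' s' T ∧
      (∀ p ∈ s', ∀ t i, p.1 ≠ MoveKind.stab t i) ∧
      ∀ t i, (s'.map Prod.fst).count (.destab t i) = (s.map Prod.fst).count (.destab t i) := by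
  induction s generalizing R with
  | nil =>
    obtain rfl : R = S := h
    exact ⟨T, [], hst, rfl, by simp, fun _ _ => rfl⟩
  | cons p s ih =>
    obtain ⟨k, M⟩ := p
    obtain ⟨M', s', hM, hs', hns, hcount⟩ := ih h.2 fun q hq => hs q (List.mem_cons_of_mem _ hq)
    obtain ⟨R', M'', hR, hk, he⟩ := KindOk.commute_stab h.1 (hs (k, M) (by simp)) hM
    obtain ⟨b, hb, hbe⟩ := he.exists_lChain
    refine ⟨R', (k, M'') :: (b ++ s'), hR, ⟨hk, lChain_append.2 ⟨M', hb, hs'⟩⟩, ?_, ?_⟩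
    · intro q hq t i
      rcases List.mem_cons.1 hq with rfl | hq
      · exact hs (k, M) (by simp) t i
      · rcases List.mem_append.1 hq with hq | hq
        · simp [hbe q hq]
        · exact hns q hq t i
    · intro t i
      have := count_map_fst_eq_zero (s := b) (k := .destab t i) fun p hp => by simp [hbe p hp]
      simp only [List.map_cons, List.map_append, List.count_cons, List.count_append, hcount, this,
        zero_add]

/-- All stabilizations of a chain may be moved to its beginning. -/
lemma LChain.stabs_first {s : List (MoveKind × RectDiagram)} {R R' : RectDiagram}
    (h : LChain R s R') :
    ∃ a b M, LChain R a M ∧ LChain M b R' ∧ (∀ p ∈ a, ∃ t i, p.1 = MoveKind.stab t i) ∧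
      (∀ p ∈ b, ∀ t i, p.1 ≠ MoveKind.stab t i) ∧
      ∀ t i, (a.map Prod.fst).count (.stab t i) = (s.map Prod.fst).count (.stab t i) ∧
        (b.map Prod.fst).count (.destab t i) = (s.map Prod.fst).count (.destab t i) := by
  induction s using List.reverseRecOn generalizing R' with
  | nil => exact ⟨[], [], R, rfl, h, by simp, by simp, fun _ _ => ⟨rfl, rfl⟩⟩
  | append_singleton s p ih =>
    obtain ⟨k, T⟩ := p
    obtain ⟨S, hs, hk, rfl⟩ := lChain_append.1 h
    obtain ⟨a, b, M, ha, hb, has, hbn, hcount⟩ := ih hs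
    by_cases hks : ∃ t i, k = MoveKind.stab t i
    · obtain ⟨t, i, rfl⟩ := hks
      obtain ⟨M', b', hM, hb', hbn', hcount'⟩ := hb.commute_stab hbn hk
      refine ⟨a ++ [(.stab t i, M')], b', M', lChain_append.2 ⟨M, ha, hM, rfl⟩, hb', fun p hp => ?_,
        hbn', fun t' i' => ?_⟩
      · rcases List.mem_append.1 hp with hp | hp
        · exact has p hp
        · exact ⟨t, i, by rw [List.mem_singleton.1 hp]⟩
      · simp [hcount, hcount', List.count_cons]
    · push Not at hks
      refine ⟨a, b ++ [(k, T)], M, ha, lChain_append.2 ⟨S, hb, hk, rfl⟩, has, fun p hp => ?_,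
        fun t' i' => ?_⟩
      · rcases List.mem_append.1 hp with hp | hp
        · exact hbn p hp
        · rw [List.mem_singleton.1 hp]
          exact hks
      · simp [hcount, List.count_cons, hks]

/-- Any chain of elementary moves from `R` to `R'` can be replaced by a chain from `R` to
`R'` consisting of stabilizations, then exchange moves, then destabilizations, with the
same number of stabilizations (resp. destabilizations) of each oriented type on each
component as in the original chain. -/
theorem chain_normal_form (R R' : RectDiagram) (s : List (MoveKind × RectDiagram))
    (hs : LChain R s R') :
    ∃ s' : List (MoveKind × RectDiagram), LChain R s' R' ∧
      (∃ a b c : List (MoveKind × RectDiagram),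
        s' = a ++ b ++ c ∧
        (∀ p ∈ a, ∃ t i, p.1 = MoveKind.stab t i) ∧
        (∀ p ∈ b, p.1 = MoveKind.exchange) ∧
        (∀ p ∈ c, ∃ t i, p.1 = MoveKind.destab t i)) ∧
      ∀ (t : OType) (i : ℕ),
        (s'.map Prod.fst).count (MoveKind.stab t i) =
          (s.map Prod.fst).count (MoveKind.stab t i) ∧
        (s'.map Prod.fst).count (MoveKind.destab t i) =
          (s.map Prod.fst).count (MoveKind.destab t i) := by
  obtain ⟨a, b, M, ha, hb, has, hbn, hab⟩ := hs.stabs_first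
  obtain ⟨b', hb', hbb'⟩ := hb.reverse
  obtain ⟨c, d, N, hc, hd, hcs, hdn, hcd⟩ := hb'.stabs_first
  obtain ⟨c', hc', hcc'⟩ := hc.reverse
  obtain ⟨d', hd', hdd'⟩ := hd.reverse
  have hc's : ∀ p ∈ c', ∃ t i, p.1 = MoveKind.destab t i := by
    intro p hp
    have : p.1 ∈ c'.map Prod.fst := List.mem_map_of_mem hp
    rw [hcc', List.mem_reverse, List.mem_map] at this
    obtain ⟨k, hk, e⟩ := this
    obtain ⟨q, hq, rfl⟩ := List.mem_map.1 hk
    obtain ⟨t, i, h⟩ := hcs q hq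
    exact ⟨t, i, by rw [← e, h]; rfl⟩
  have hd's : ∀ p ∈ d', p.1 = MoveKind.exchange := by
    intro p hp
    have hstab : ∀ t i, p.1 ≠ MoveKind.stab t i := fun t i =>
      forall_ne_of_count_eq_zero (by
        rw [hdd', count_map_reverse, MoveKind.reverse, (hcd t i).2, hbb', count_map_reverse]
        exact count_map_fst_eq_zero fun q hq => hbn q hq t i) p hp
    have hdestab : ∀ t i, p.1 ≠ MoveKind.destab t i := fun t i =>
      forall_ne_of_count_eq_zero (by
        rw [hdd', count_map_reverse]
        exact count_map_fst_eq_zero fun q hq => hdn q hq t i) p hp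
    rcases h : p.1 with _ | ⟨t, i⟩ | ⟨t, i⟩
    · rfl
    · exact absurd h (hstab t i)
    · exact absurd h (hdestab t i)
  refine ⟨a ++ d' ++ c', lChain_append.2 ⟨N, lChain_append.2 ⟨M, ha, hd'⟩, hc'⟩,
    ⟨a, d', c', rfl, has, hd's, hc's⟩, fun t i => ?_⟩
  simp only [List.map_append, List.count_append]
  rw [count_map_fst_eq_zero (s := d') (k := .stab t i) fun p hp => by simp [hd's p hp],
    count_map_fst_eq_zero (s := d') (k := .destab t i) fun p hp => by simp [hd's p hp],
    count_map_fst_eq_zero (s := c') (k := .stab t i) fun p hp => by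
      obtain ⟨_, _, h⟩ := hc's p hp
      simp [h],
    count_map_fst_eq_zero (s := a) (k := .destab t i) fun p hp => by
      obtain ⟨_, _, h⟩ := has p hp
      simp [h], hcc', count_map_reverse, MoveKind.reverse, (hcd t i).1, hbb', count_map_reverse,
    MoveKind.reverse, (hab t i).1, (hab t i).2]
  simp

end RectDiag
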